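/- Let $(M,g)$ be a smooth four-dimensional Lorentzian spacetime of signature $(+,-,-,-)$ with Levi-Civita connection $\nabla_a=\nabla_{AA'}$, and let $(o^A,\iota^A)$ be a smooth spin dyad on $M$ normalised by $o_A\iota^A=1$, with null tetrad $l^a=o^A\bar o^{A'}$, $n^a=\iota^A\bar\iota^{A'}$, $m^a=o^A\bar\iota^{A'}$, so that $g_{ab}=\epsilon_{AB}\bar\epsilon_{A'B'}$. Write $D=l^a\nabla_a$, $D'=n^a\nabla_a$, $\delta=m^a\nabla_a$, $\delta'=\bar m^a\nabla_a$ and let $$\rho=o^A\delta' o_A,\quad \tau=o^AD'o_A,\quad \varepsilon=\iota^ADo_A,\quad \beta=\iota^A\delta o_A,$$ $$\rho'=-\iota^A\delta\iota_A,\quad \tau'=-\iota^AD\iota_A,\quad \varepsilon'=-o^AD'\iota_A,\quad \beta'=-o^A\delta'\iota_A$$ be the GHP spin coefficients. Put $$\omega_a=-\varepsilon n_a+\varepsilon' l_a-\beta' m_a+\beta\bar m_a,\qquad B_a=-\rho n_a+\tau\bar m_a,\qquad f_a=\rho n_a+\rho' l_a-\tau' m_a-\tau\bar m_a .$$ For $p\in\mathbb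 Z$ and $w\in\mathbb R$, the conformal-GHP connection acts on a smooth spinor field $\varphi$ with arbitrarily many indices of each kind, of GHP weight $\{p,0\}$ and conformal weight $w$, by $$\mathcal C_{AA'}\varphi^{B\dots B'\dots}_{C\dots C'\dots}=\nabla_{AA'}\varphi^{B\dots B'\dots}_{C\dots C'\dots}+\bigl(wf_{AA'}+p(\omega_{AA'}+B_{AA'})\bigr)\varphi^{B\dots B'\dots}_{C\dots C'\dots}+\epsilon_A{}^Bf_{QA'}\varphi^{Q\dots B'\dots}_{C\dots C'\dots}+\epsilon_{A'}{}^{B'}f_{AQ'}\varphi^{B\dots Q'\dots}_{C\dots C'\dots}-f_{CA'}\varphi^{B\dots B'\dots}_{A\dots C'\dots}-f_{AC'}\varphi^{B\dots B'\dots}_{C\dots A'\dots}+\cdots,$$ with one correction term of the displayed type for each index of $\varphi$. Let $\tilde{\mathcal C}_{A'}=o^A\mathcal C_{AA'}$; then $\tilde{\mathcal C}_{A'}\varphi$ has one more lower primed index, GHP weight $\{p+1,0\}$ and conformal weight $w$, and $$[\tilde{\mathcal C}_{A'},\tilde{\mathcal C}_{B'}]\varphi=\tilde{\mathcal C}_{A'}\tilde{\mathcal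 C}_{B'}\varphi-\tilde{\mathcal C}_{B'}\tilde{\mathcal C}_{A'}\varphi .$$ Suppose that $o^A$ is a shear-free ray, i.e. $o^Ao^B\nabla_{AA'}o_B=0$. Then $[\tilde{\mathcal C}_{A'},\tilde{\mathcal C}_{B'}]\varphi=0$ for all smooth spinor fields $\varphi$ of every index structure, every GHP weight $\{p,0\}$ and every conformal weight $w$, if and only if $o^A$ is a repeated principal spinor of the Weyl spinor $\Psi_{ABCD}$ of $g$ (the totally symmetric part of $\tfrac14R_{AX'B}{}^{X'}{}_{CY'D}{}^{Y'}$), i.e. $$\Psi_{ABCD}\,o^Bo^Co^D=0 .$$ -/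

import Mathlib

open scoped Manifold ContDiff ComplexConjugate

noncomputable section

/-- A smooth Lorentzian metric of signature `(+,-,-,-)` on a smooth 4-manifold. -/
structure LorentzianMetric (M : Type*) [TopologicalSpace M]
    [ChartedSpace (EuclideanSpace ℝ (Fin 4)) M] [IsManifold (𝓡 4) ∞ M] where
  /-- The bilinear form on each tangent space. -/
  inner (x : M) : TangentSpace (𝓡 4) x →L[ℝ] TangentSpace (𝓡 4) x →L[ℝ] ℝ
  symm (x : M) (v w : TangentSpace (𝓡 4) x) : inner x v w = inner x w v
  signature (x : M) : ∃ b : Module.Basis (Fin 4) ℝ (TangentSpace (𝓡 4) x),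
    ∀ i j, inner x (b i) (b j) = Matrix.diagonal ![(1 : ℝ), -1, -1, -1] i j
  contMDiff : ContMDiff (𝓡 4)
    ((𝓡 4).prod 𝓘(ℝ, EuclideanSpace ℝ (Fin 4) →L[ℝ] EuclideanSpace ℝ (Fin 4) →L[ℝ] ℝ)) ∞
    (fun x ↦ Bundle.TotalSpace.mk'
      (EuclideanSpace ℝ (Fin 4) →L[ℝ] EuclideanSpace ℝ (Fin 4) →L[ℝ] ℝ) x (inner x))

/-- The Gram matrix of the real frame `(l, n, Re m, Im m)` of a null tetrad:
`l·n = 1`, `m·m̄ = -1`, all other products of `l, n, m, m̄` vanish. -/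
def nullGram : Matrix (Fin 4) (Fin 4) ℝ :=
  !![0, 1, 0, 0; 1, 0, 0, 0; 0, 0, -1/2, 0; 0, 0, 0, -1/2]

/-- The inverse of `nullGram`. -/
def nullGramInv : Matrix (Fin 4) (Fin 4) ℝ :=
  !![0, 1, 0, 0; 1, 0, 0, 0; 0, 0, -2, 0; 0, 0, 0, -2]

/-- A (normalised, `o_A ι^A = 1`) smooth spin dyad `(o^A, ι^A)` on the Lorentzian spacetime `(M, g)`.

A spin dyad is a global frame of the spinor bundle `S`, so it identifies `S` with `M × ℂ²` and its
symplectic form with the standard one, and the only remaining datum is the isomorphism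
`TM ⊗ ℂ ≅ S ⊗ S̄` with `g_ab = ε_AB ε̄_A'B'`.  That isomorphism is the same thing as the smooth null
tetrad `l = o ō`, `n = ι ῑ`, `m = o ῑ`, recorded here by its real frame `(l, n, Re m, Im m)`.
All spinor fields below are given by their components with respect to `(o, ι)`. -/
structure SpinDyad {M : Type*} [TopologicalSpace M]
    [ChartedSpace (EuclideanSpace ℝ (Fin 4)) M] [IsManifold (𝓡 4) ∞ M]
    (g : LorentzianMetric M) where
  /-- The real frame `![l, n, Re m, Im m]`. -/
  frame : Fin 4 → (x : M) → TangentSpace (𝓡 4) x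
  contMDiff_frame (i : Fin 4) : ContMDiff (𝓡 4) (𝓡 4).tangent ∞
    (fun x ↦ (⟨x, frame i x⟩ : TangentBundle (𝓡 4) M))
  gram (x : M) (i j : Fin 4) : g.inner x (frame i x) (frame j x) = nullGram i j

/-- Components of `e_{AA'}` in the real frame `(l, n, Re m, Im m)`:
`e_{00'} = l`, `e_{01'} = m`, `e_{10'} = m̄`, `e_{11'} = n`. -/
def solder : Fin 2 → Fin 2 → Fin 4 → ℂ :=
  ![![![1, 0, 0, 0], ![0, 0, 1, Complex.I]], ![![0, 0, 1, -Complex.I], ![0, 1, 0, 0]]]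

/-- The components of `ε_AB` and of `ε^AB` in a normalised dyad. -/
def spinEps : Matrix (Fin 2) (Fin 2) ℂ := !![0, 1; -1, 0]

/-- Components `o^A`. -/
def spinO : Fin 2 → ℂ := ![1, 0]

/-- Components `ι^A`. -/
def spinIota : Fin 2 → ℂ := ![0, 1]

/-- Lowering a spinor index, `ξ_A = ξ^B ε_BA`. -/
def spinLower (ξ : Fin 2 → ℂ) (A : Fin 2) : ℂ := ∑ B, ξ B * spinEps B A

/-- The Kronecker delta `ε_A^B`. -/
def spinDelta (A B : Fin 2) : ℂ := if A = B then 1 else 0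

/-- The covector `ξ_A η̄_A'`; thus `l_a, n_a, m_a, m̄_a` are `o_A ō_A'`, `ι_A ῑ_A'`, `o_A ῑ_A'`,
`ι_A ō_A'`. -/
def spinCovector (ξ η : Fin 2 → ℂ) (A A' : Fin 2) : ℂ := spinLower ξ A * conj (spinLower η A')

/-- The four kinds of spinor indices: `ξ^A`, `ξ_A`, `ξ^A'`, `ξ_A'`. -/
inductive SpinorIndex where
  | up
  | down
  | upPrime
  | downPrime

/-- Component functions, in the dyad, of a spinor field with `k` indices; the kinds of the indices
are recorded separately by a map `Fin k → SpinorIndex`. -/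
abbrev SpinorField (M : Type*) (k : ℕ) := (Fin k → Fin 2) → M → ℂ

namespace SpinDyad

variable {M : Type*} [TopologicalSpace M]
  [ChartedSpace (EuclideanSpace ℝ (Fin 4)) M] [IsManifold (𝓡 4) ∞ M]
  {g : LorentzianMetric M} (D : SpinDyad g)

/-! ### Levi-Civita connection and curvature in the frame -/

/-- The derivative `e_i f` of a complex function along the `i`-th real frame vector field. -/
def frameDeriv (i : Fin 4) (f : M → ℂ) (x : M) : ℂ :=
  (mfderiv (𝓡 4) 𝓘(ℝ, ℂ) f x (D.frame i x) : ℂ)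

/-- `g([e_i, e_j], e_k)`, a real function regarded as a complex one. -/
def bracketCoeff (i j k : Fin 4) (x : M) : ℂ :=
  ((g.inner x (VectorField.mlieBracket (𝓡 4) (D.frame i) (D.frame j) x) (D.frame k x) : ℝ) : ℂ)

/-- The connection coefficients `G_ijk = g(∇_{e_i} e_j, e_k)` of the Levi-Civita connection, by the
Koszul formula (the products `g(e_i, e_j)` are constant). -/
def connCoeff (i j k : Fin 4) (x : M) : ℂ :=
  (D.bracketCoeff i j k x - D.bracketCoeff i k j x - D.bracketCoeff j k i x) / 2

/-- The Riemann tensor `R_ijkl = g(R(e_i, e_j) e_k, e_l)` with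
`R(X, Y) Z = ∇_X ∇_Y Z - ∇_Y ∇_X Z - ∇_[X,Y] Z`. -/
def riemann (i j k l : Fin 4) (x : M) : ℂ :=
  D.frameDeriv i (D.connCoeff j k l) x - D.frameDeriv j (D.connCoeff i k l) x
    + ∑ a, ∑ b, (nullGramInv a b : ℂ) *
        (D.connCoeff j k a x * D.connCoeff i b l x
          - D.connCoeff i k a x * D.connCoeff j b l x
          - D.bracketCoeff i j a x * D.connCoeff b k l x)

/-- The spinor components `R_{AA'BB'CC'DD'}` of the Riemann tensor; the arguments are
`A A' B B' C C' D D'` in this order. -/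
def riemannSpinor (A A' B B' C C' E E' : Fin 2) (x : M) : ℂ :=
  ∑ i, ∑ j, ∑ k, ∑ l,
    solder A A' i * solder B B' j * solder C C' k * solder E E' l * D.riemann i j k l x

/-- `X_ABCD = ¼ R_{AX'B}^{X'}_{CY'D}^{Y'}`. -/
def curvSpinor (I : Fin 4 → Fin 2) (x : M) : ℂ :=
  (1 / 4) * ∑ A', ∑ B', ∑ C', ∑ E', spinEps A' B' * spinEps C' E' *
    D.riemannSpinor (I 0) A' (I 1) B' (I 2) C' (I 3) E' x

/-- The Weyl spinor `Ψ_ABCD = X_(ABCD)`, the totally symmetric part of `X_ABCD`. -/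
def weylSpinor (A B C E : Fin 2) (x : M) : ℂ :=
  (1 / 24) * ∑ s : Equiv.Perm (Fin 4), D.curvSpinor (fun i ↦ ![A, B, C, E] (s i)) x

/-! ### Covariant derivative of spinor fields -/

/-- The derivative of a complex function along the complex vector field `e_{AA'}`. -/
def partialD (A A' : Fin 2) (f : M → ℂ) (x : M) : ℂ :=
  ∑ i, solder A A' i * D.frameDeriv i f x

/-- `g(∇_{AA'} e_{BB'}, e_{CC'})`, the complex-multilinear extension of `connCoeff`. -/
def connSpinor (A A' B B' C C' : Fin 2) (x : M) : ℂ :=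
  ∑ i, ∑ j, ∑ k, solder A A' i * solder B B' j * solder C C' k * D.connCoeff i j k x

/-- The spin connection coefficients `Γ_{AA'B}^C`, so that
`∇_{AA'} ξ^C = ∂_{AA'} ξ^C + Γ_{AA'B}^C ξ^B`.  They are determined by `∇ ε = 0` and by
`∇_{AA'} e_{BB'} = Γ_{AA'B}^C e_{CB'} + Γ̄_{AA'B'}^{C'} e_{BC'}`, i.e. equal to half the trace over
the primed indices of the Levi-Civita coefficients. -/
def spinConn (A A' B C : Fin 2) (x : M) : ℂ :=
  (1 / 2) * ∑ B', ∑ E, ∑ E', spinEps C E * spinEps B' E' * D.connSpinor A A' B B' E E' x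

/-- The coefficient with which `∇_{AA'}` maps the `Q`-component to the `B`-component in an index of
the given kind.  Primed indices carry the complex conjugate connection,
`Γ̄_{AA'B'}^{C'}` being the conjugate of `Γ_{A'A B}^C`. -/
def indexConn (A A' : Fin 2) : SpinorIndex → Fin 2 → Fin 2 → M → ℂ
  | .up, B, Q, x => D.spinConn A A' Q B x
  | .down, B, Q, x => -D.spinConn A A' B Q x
  | .upPrime, B, Q, x => conj (D.spinConn A' A Q B x)
  | .downPrime, B, Q, x => -conj (D.spinConn A' A B Q x)

/-- The spinor covariant derivative `∇_{AA'} φ` on fields with arbitrary index structure. -/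
def nabla {k : ℕ} (τ : Fin k → SpinorIndex) (φ : SpinorField M k) (A A' : Fin 2) :
    SpinorField M k := fun I x ↦
  D.partialD A A' (φ I) x
    + ∑ i, ∑ Q, D.indexConn A A' (τ i) (I i) Q x * φ (Function.update I i Q) x

/-! ### Shear-free rays and GHP spin coefficients -/

/-- `∇_{AA'} ξ_B` for a spinor `ξ` with constant components `ξ^B` in the dyad. -/
def nablaLower (ξ : Fin 2 → ℂ) (A A' B : Fin 2) (x : M) : ℂ :=
  D.nabla ![SpinorIndex.down] (fun I _ ↦ spinLower ξ (I 0)) A A' ![B] x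

/-- `o^A` is a shear-free ray: `o^A o^B ∇_{AA'} o_B = 0`. -/
def IsShearFreeRay : Prop :=
  ∀ (A' : Fin 2) (x : M), ∑ A, ∑ B, spinO A * spinO B * D.nablaLower spinO A A' B x = 0

/-- `α^A β̄^A' γ^B ∇_{AA'} ξ_B`. -/
def spinCoeff (α β γ ξ : Fin 2 → ℂ) (x : M) : ℂ :=
  ∑ A, ∑ A', ∑ B, α A * conj (β A') * γ B * D.nablaLower ξ A A' B x

/-- `ρ = o^A δ' o_A`, with `δ' = m̄^a ∇_a`. -/
def rho : M → ℂ := D.spinCoeff spinIota spinO spinO spinO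

/-- `τ = o^A D' o_A`, with `D' = n^a ∇_a`. -/
def tau : M → ℂ := D.spinCoeff spinIota spinIota spinO spinO

/-- `ε = ι^A D o_A`, with `D = l^a ∇_a`. -/
def eps : M → ℂ := D.spinCoeff spinO spinO spinIota spinO

/-- `β = ι^A δ o_A`, with `δ = m^a ∇_a`. -/
def beta : M → ℂ := D.spinCoeff spinO spinIota spinIota spinO

/-- The GHP-primed coefficient `ρ' = -ι^A δ ι_A` (the prime is `o ↦ i ι`, `ι ↦ i o`). -/
def rhoP : M → ℂ := -D.spinCoeff spinO spinIota spinIota spinIota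

/-- The GHP-primed coefficient `τ' = -ι^A D ι_A`. -/
def tauP : M → ℂ := -D.spinCoeff spinO spinO spinIota spinIota

/-- The GHP-primed coefficient `ε' = -o^A D' ι_A`. -/
def epsP : M → ℂ := -D.spinCoeff spinIota spinIota spinO spinIota

/-- The GHP-primed coefficient `β' = -o^A δ' ι_A`. -/
def betaP : M → ℂ := -D.spinCoeff spinIota spinO spinO spinIota

/-! ### The conformal-GHP connection -/

/-- `ω_a = -ε n_a + ε' l_a - β' m_a + β m̄_a`. -/
def formOmega (A A' : Fin 2) (x : M) : ℂ :=
  -D.eps x * spinCovector spinIota spinIota A A' + D.epsP x * spinCovector spinO spinO A A'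
    - D.betaP x * spinCovector spinO spinIota A A' + D.beta x * spinCovector spinIota spinO A A'

/-- `B_a = -ρ n_a + τ m̄_a`. -/
def formB (A A' : Fin 2) (x : M) : ℂ :=
  -D.rho x * spinCovector spinIota spinIota A A' + D.tau x * spinCovector spinIota spinO A A'

/-- `f_a = ρ n_a + ρ' l_a - τ' m_a - τ m̄_a`. -/
def formF (A A' : Fin 2) (x : M) : ℂ :=
  D.rho x * spinCovector spinIota spinIota A A' + D.rhoP x * spinCovector spinO spinO A A'
    - D.tauP x * spinCovector spinO spinIota A A' - D.tau x * spinCovector spinIota spinO A A'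

/-- The coefficient of the `Q`-component in the `f`-correction of `C_{AA'}` for an index of the given
kind with value `B`: `ε_A^B f_QA'`, `-f_BA' ε_A^Q`, `ε_A'^B f_AQ`, `-f_AB ε_A'^Q` respectively. -/
def indexCorr (A A' : Fin 2) : SpinorIndex → Fin 2 → Fin 2 → M → ℂ
  | .up, B, Q, x => spinDelta A B * D.formF Q A' x
  | .down, B, Q, x => -(D.formF B A' x * spinDelta A Q)
  | .upPrime, B, Q, x => spinDelta A' B * D.formF A Q x
  | .downPrime, B, Q, x => -(D.formF A B x * spinDelta A' Q)

/-- The conformal-GHP derivative `C_{AA'} φ` of a spinor field of GHP weight `{p,0}` and conformal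
weight `w`. -/
def conformalGHP {k : ℕ} (τ : Fin k → SpinorIndex) (p : ℤ) (w : ℝ) (φ : SpinorField M k)
    (A A' : Fin 2) : SpinorField M k := fun I x ↦
  D.nabla τ φ A A' I x
    + ((w : ℂ) * D.formF A A' x + (p : ℂ) * (D.formOmega A A' x + D.formB A A' x)) * φ I x
    + ∑ i, ∑ Q, D.indexCorr A A' (τ i) (I i) Q x * φ (Function.update I i Q) x

/-- `C̃_{A'} φ = o^A C_{AA'} φ`.  The result has the additional lower primed index `A'`, put first;
its GHP weight is `{p+1,0}` and its conformal weight is `w`. -/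
def cTilde {k : ℕ} (τ : Fin k → SpinorIndex) (p : ℤ) (w : ℝ) (φ : SpinorField M k) :
    SpinorField M (k + 1) := fun J x ↦
  ∑ A, spinO A * D.conformalGHP τ p w φ A (J 0) (Fin.tail J) x

/-- `C̃_{A'} C̃_{B'} φ`, with `A'` the first and `B'` the second index: the outer operator acts on a
field with one more lower primed index and with GHP weight `{p+1,0}`. -/
def cTildeSq {k : ℕ} (τ : Fin k → SpinorIndex) (p : ℤ) (w : ℝ) (φ : SpinorField M k) :
    SpinorField M (k + 2) :=
  D.cTilde (Fin.cons (α := fun _ ↦ SpinorIndex) SpinorIndex.downPrime τ) (p + 1) w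
    (D.cTilde τ p w φ)

/-- The commutator `[C̃_{A'}, C̃_{B'}] φ`. -/
def cTildeComm {k : ℕ} (τ : Fin k → SpinorIndex) (p : ℤ) (w : ℝ) (φ : SpinorField M k)
    (A' B' : Fin 2) : SpinorField M k := fun I x ↦
  D.cTildeSq τ p w φ
      (Fin.cons (α := fun _ ↦ Fin 2) A' (Fin.cons (α := fun _ ↦ Fin 2) B' I)) x
    - D.cTildeSq τ p w φ
      (Fin.cons (α := fun _ ↦ Fin 2) B' (Fin.cons (α := fun _ ↦ Fin 2) A' I)) x

/-- `o^A` is a repeated principal spinor of the Weyl spinor: `Ψ_ABCD o^B o^C o^D = 0`. -/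
def IsRepeatedPrincipal : Prop :=
  ∀ (A : Fin 2) (x : M),
    ∑ B, ∑ C, ∑ E, D.weylSpinor A B C E x * spinO B * spinO C * spinO E = 0

end SpinDyad

end

noncomputable section

set_option linter.unusedSectionVars false

namespace SpinDyad

variable {M : Type*} [TopologicalSpace M]
  [ChartedSpace (EuclideanSpace ℝ (Fin 4)) M] [IsManifold (𝓡 4) ∞ M]
  {g : LorentzianMetric M} (D : SpinDyad g)

/-! ### Calculus in the frame -/

/-- The derivative along a vector field of a smooth vector-valued function is smooth. -/
theorem contMDiff_mvfderiv_apply {F : Type*} [NormedAddCommGroup F] [NormedSpace ℝ F] {f : M → F}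
    (hf : ContMDiff (𝓡 4) 𝓘(ℝ, F) ∞ f) {V : (x : M) → TangentSpace (𝓡 4) x}
    (hV : ContMDiff (𝓡 4) (𝓡 4).tangent ∞ (fun x ↦ (⟨x, V x⟩ : TangentBundle (𝓡 4) M))) :
    ContMDiff (𝓡 4) 𝓘(ℝ, F) ∞ (fun x ↦ mvfderiv (𝓡 4) f x (V x)) := by
  have h1 : ContMDiff (𝓡 4).tangent 𝓘(ℝ, F).tangent ∞ (tangentMap (𝓡 4) 𝓘(ℝ, F) f) :=
    hf.contMDiff_tangentMap (by simp)
  exact (contMDiff_snd_tangentBundle_modelSpace F 𝓘(ℝ, F)).comp (h1.comp hV)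

theorem mdifferentiableAt_of_contMDiff {F : Type*} [NormedAddCommGroup F] [NormedSpace ℝ F]
    {f : M → F} (hf : ContMDiff (𝓡 4) 𝓘(ℝ, F) ∞ f) (x : M) :
    MDifferentiableAt (𝓡 4) 𝓘(ℝ, F) f x :=
  (hf x).mdifferentiableAt (by simp)

theorem mdifferentiableAt_section {V : (x : M) → TangentSpace (𝓡 4) x}
    (hV : ContMDiff (𝓡 4) (𝓡 4).tangent ∞ (fun x ↦ (⟨x, V x⟩ : TangentBundle (𝓡 4) M)))
    (x : M) : MDifferentiableAt (𝓡 4) (𝓡 4).tangent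
      (fun x ↦ (⟨x, V x⟩ : TangentBundle (𝓡 4) M)) x :=
  (hV x).mdifferentiableAt (by simp)

theorem contMDiff_mlieBracket {V W : (x : M) → TangentSpace (𝓡 4) x}
    (hV : ContMDiff (𝓡 4) (𝓡 4).tangent ∞ (fun x ↦ (⟨x, V x⟩ : TangentBundle (𝓡 4) M)))
    (hW : ContMDiff (𝓡 4) (𝓡 4).tangent ∞ (fun x ↦ (⟨x, W x⟩ : TangentBundle (𝓡 4) M))) :
    ContMDiff (𝓡 4) (𝓡 4).tangent ∞
      (fun x ↦ (⟨x, VectorField.mlieBracket (𝓡 4) V W x⟩ : TangentBundle (𝓡 4) M)) := by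
  have : IsManifold (𝓡 4) (((⊤ : ℕ∞) : WithTop ℕ∞) + 1) M := by
    simpa using (inferInstance : IsManifold (𝓡 4) ∞ M)
  have : IsManifold (𝓡 4) (minSmoothness ℝ 2) M := by
    simpa using (IsManifold.of_le (I := 𝓡 4) (M := M) (m := 2) (n := ∞) ENat.LEInfty.out)
  exact ContDiff.mlieBracket_vectorField (m := ⊤) (n := ⊤) hV hW (by simp)

/-- Leibniz identity for smooth fields. -/
theorem leibniz_mlieBracket {U V W : (x : M) → TangentSpace (𝓡 4) x}
    (hU : ContMDiff (𝓡 4) (𝓡 4).tangent ∞ (fun x ↦ (⟨x, U x⟩ : TangentBundle (𝓡 4) M)))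
    (hV : ContMDiff (𝓡 4) (𝓡 4).tangent ∞ (fun x ↦ (⟨x, V x⟩ : TangentBundle (𝓡 4) M)))
    (hW : ContMDiff (𝓡 4) (𝓡 4).tangent ∞ (fun x ↦ (⟨x, W x⟩ : TangentBundle (𝓡 4) M)))
    (x : M) :
    VectorField.mlieBracket (𝓡 4) U (VectorField.mlieBracket (𝓡 4) V W) x =
      VectorField.mlieBracket (𝓡 4) (VectorField.mlieBracket (𝓡 4) U V) W x
      + VectorField.mlieBracket (𝓡 4) V (VectorField.mlieBracket (𝓡 4) U W) x := by
  have e : minSmoothness ℝ 2 = 2 := by simp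
  have : IsManifold (𝓡 4) (minSmoothness ℝ 3) M := by
    simpa using (IsManifold.of_le (I := 𝓡 4) (M := M) (m := 3) (n := ∞) ENat.LEInfty.out)
  refine VectorField.leibniz_identity_mlieBracket_apply ?_ ?_ ?_ <;> rw [e]
  · exact (hU x).of_le ENat.LEInfty.out
  · exact (hV x).of_le ENat.LEInfty.out
  · exact (hW x).of_le ENat.LEInfty.out

theorem contMDiff_smul_section {f : M → ℝ} (hf : ContMDiff (𝓡 4) 𝓘(ℝ, ℝ) ∞ f)
    {V : (x : M) → TangentSpace (𝓡 4) x}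
    (hV : ContMDiff (𝓡 4) (𝓡 4).tangent ∞ (fun x ↦ (⟨x, V x⟩ : TangentBundle (𝓡 4) M))) :
    ContMDiff (𝓡 4) (𝓡 4).tangent ∞
      (fun x ↦ (⟨x, (f • V) x⟩ : TangentBundle (𝓡 4) M)) :=
  ContMDiff.smul_section (V := TangentSpace (𝓡 4)) hf hV

/-- The derivative along `[V, W]` is the commutator of the derivatives along `V` and `W`. -/
theorem mvfderiv_mlieBracket_smul {f : M → ℝ} (hf : ContMDiff (𝓡 4) 𝓘(ℝ, ℝ) ∞ f)
    {U V W : (x : M) → TangentSpace (𝓡 4) x}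
    (hU : ContMDiff (𝓡 4) (𝓡 4).tangent ∞ (fun x ↦ (⟨x, U x⟩ : TangentBundle (𝓡 4) M)))
    (hV : ContMDiff (𝓡 4) (𝓡 4).tangent ∞ (fun x ↦ (⟨x, V x⟩ : TangentBundle (𝓡 4) M)))
    (hW : ContMDiff (𝓡 4) (𝓡 4).tangent ∞ (fun x ↦ (⟨x, W x⟩ : TangentBundle (𝓡 4) M)))
    (x : M) :
    mvfderiv (𝓡 4) f x (VectorField.mlieBracket (𝓡 4) U V x) • W x
      = (mvfderiv (𝓡 4) (fun y ↦ mvfderiv (𝓡 4) f y (V y)) x (U x)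
        - mvfderiv (𝓡 4) (fun y ↦ mvfderiv (𝓡 4) f y (U y)) x (V x)) • W x := by
  have : IsManifold (𝓡 4) (minSmoothness ℝ 2) M := by
    simpa using (IsManifold.of_le (I := 𝓡 4) (M := M) (m := 2) (n := ∞) ENat.LEInfty.out)
  have key : ∀ {A B : (x : M) → TangentSpace (𝓡 4) x}
    (_ : ContMDiff (𝓡 4) (𝓡 4).tangent ∞ (fun x ↦ (⟨x, A x⟩ : TangentBundle (𝓡 4) M)))
    (_ : ContMDiff (𝓡 4) (𝓡 4).tangent ∞ (fun x ↦ (⟨x, B x⟩ : TangentBundle (𝓡 4) M))),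
      VectorField.mlieBracket (𝓡 4) A (VectorField.mlieBracket (𝓡 4) B (f • W)) x
        = mvfderiv (𝓡 4) (fun y ↦ mvfderiv (𝓡 4) f y (B y)) x (A x) • W x
          + mvfderiv (𝓡 4) f x (B x) • VectorField.mlieBracket (𝓡 4) A W x
          + (mvfderiv (𝓡 4) f x (A x) • VectorField.mlieBracket (𝓡 4) B W x
          + f x • VectorField.mlieBracket (𝓡 4) A (VectorField.mlieBracket (𝓡 4) B W) x) := by
    intro A B hA hB
    have h1 : VectorField.mlieBracket (𝓡 4) B (f • W)
        = (fun y ↦ mvfderiv (𝓡 4) f y (B y)) • W + f • VectorField.mlieBracket (𝓡 4) B W := by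
      funext y
      exact VectorField.mlieBracket_smul_right (mdifferentiableAt_of_contMDiff hf y)
        (mdifferentiableAt_section hW y)
    have hd := contMDiff_mvfderiv_apply hf hB
    have hBW := contMDiff_mlieBracket hB hW
    rw [h1, VectorField.mlieBracket_add_right
      (mdifferentiableAt_section (contMDiff_smul_section hd hW) x)
      (mdifferentiableAt_section (contMDiff_smul_section hf hBW) x),
      VectorField.mlieBracket_smul_right (mdifferentiableAt_of_contMDiff hd x)
        (mdifferentiableAt_section hW x),
      VectorField.mlieBracket_smul_right (mdifferentiableAt_of_contMDiff hf x)
        (mdifferentiableAt_section hBW x)]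
  have h := leibniz_mlieBracket hU hV (contMDiff_smul_section hf hW) x
  rw [key hU hV, key hV hU, VectorField.mlieBracket_smul_right
    (mdifferentiableAt_of_contMDiff hf x) (mdifferentiableAt_section hW x),
    leibniz_mlieBracket hU hV hW x] at h
  rw [← sub_eq_zero] at h ⊢
  rw [← neg_eq_zero, ← h]
  module

theorem linearIndependent_frame (x : M) : LinearIndependent ℝ (fun i ↦ D.frame i x) := by
  rw [Fintype.linearIndependent_iff]
  intro c hc
  have h : ∀ j, ∑ i, c i * nullGram i j = 0 := fun j ↦ by
    have := congrArg (fun v ↦ g.inner x v (D.frame j x)) hc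
    simpa [D.gram] using this
  intro i
  have h0 := h 0
  have h1 := h 1
  have h2 := h 2
  have h3 := h 3
  simp [Fin.sum_univ_four, nullGram] at h0 h1 h2 h3
  fin_cases i <;> assumption

/-- Expansion of a tangent vector in the frame. -/
theorem eq_sum_frame (x : M) (v : TangentSpace (𝓡 4) x) :
    v = ∑ b, (∑ a, nullGramInv a b * g.inner x v (D.frame a x)) • D.frame b x := by
  have hcard : Fintype.card (Fin 4) = Module.finrank ℝ (TangentSpace (𝓡 4) x) := by
    change _ = Module.finrank ℝ (EuclideanSpace ℝ (Fin 4))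
    simp
  let B := basisOfLinearIndependentOfCardEqFinrank (D.linearIndependent_frame x) hcard
  have hB : ∀ i, B i = D.frame i x := fun i ↦ by simp [B]
  have hv := B.sum_repr v
  simp only [hB] at hv
  generalize hc : (fun i ↦ B.repr v i) = c
  have hc' : ∀ i, B.repr v i = c i := fun i ↦ congrFun hc i
  simp only [hc'] at hv
  subst hv
  refine Finset.sum_congr rfl fun b _ ↦ ?_
  congr 1
  simp only [map_sum, map_smul, FunLike.coe_sum, Finset.sum_apply, FunLike.coe_smul, Pi.smul_apply,
    D.gram, smul_eq_mul]
  fin_cases b <;> simp [Fin.sum_univ_four, nullGram, nullGramInv] <;> ring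

/-- `eq_sum_frame` for a bracket of frame fields, as an identity of vector fields. -/
theorem mlieBracket_frame (i j : Fin 4) :
    VectorField.mlieBracket (𝓡 4) (D.frame i) (D.frame j)
      = ∑ b, (fun x ↦ ∑ a, nullGramInv a b *
          g.inner x (VectorField.mlieBracket (𝓡 4) (D.frame i) (D.frame j) x) (D.frame a x))
            • D.frame b := by
  funext x
  rw [Finset.sum_apply]
  exact D.eq_sum_frame x _

theorem contMDiff_inner {V W : (x : M) → TangentSpace (𝓡 4) x}
    (hV : ContMDiff (𝓡 4) (𝓡 4).tangent ∞ (fun x ↦ (⟨x, V x⟩ : TangentBundle (𝓡 4) M)))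
    (hW : ContMDiff (𝓡 4) (𝓡 4).tangent ∞ (fun x ↦ (⟨x, W x⟩ : TangentBundle (𝓡 4) M))) :
    ContMDiff (𝓡 4) 𝓘(ℝ, ℝ) ∞ (fun x ↦ g.inner x (V x) (W x)) := by
  have h := ContMDiff.clm_bundle_apply₂ (F₁ := EuclideanSpace ℝ (Fin 4))
    (F₂ := EuclideanSpace ℝ (Fin 4)) (F₃ := ℝ) (E₃ := Bundle.Trivial M ℝ)
    (b := fun x : M ↦ x) g.contMDiff hV hW
  exact fun x ↦ (Bundle.contMDiffAt_totalSpace.1 (h x)).2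

/-! ### The derivations `frameDeriv` -/

theorem frameDeriv_eq (i : Fin 4) (f : M → ℂ) (x : M) :
    D.frameDeriv i f x = mvfderiv (𝓡 4) f x (D.frame i x) := rfl

variable {f h : M → ℂ}

theorem contMDiff_frameDeriv (i : Fin 4) (hf : ContMDiff (𝓡 4) 𝓘(ℝ, ℂ) ∞ f) :
    ContMDiff (𝓡 4) 𝓘(ℝ, ℂ) ∞ (D.frameDeriv i f) :=
  contMDiff_mvfderiv_apply hf (D.contMDiff_frame i)

theorem frameDeriv_add (i : Fin 4) (hf : ContMDiff (𝓡 4) 𝓘(ℝ, ℂ) ∞ f)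
    (hh : ContMDiff (𝓡 4) 𝓘(ℝ, ℂ) ∞ h) (x : M) :
    D.frameDeriv i (fun y ↦ f y + h y) x = D.frameDeriv i f x + D.frameDeriv i h x := by
  simp only [frameDeriv_eq]
  rw [mvfderiv_fun_add (mdifferentiableAt_of_contMDiff hf x) (mdifferentiableAt_of_contMDiff hh x)]
  rfl

theorem frameDeriv_const (i : Fin 4) (c : ℂ) (x : M) : D.frameDeriv i (fun _ ↦ c) x = 0 := by
  rw [frameDeriv_eq, mvfderiv_const]
  rfl

theorem frameDeriv_mul (i : Fin 4) (hf : ContMDiff (𝓡 4) 𝓘(ℝ, ℂ) ∞ f)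
    (hh : ContMDiff (𝓡 4) 𝓘(ℝ, ℂ) ∞ h) (x : M) :
    D.frameDeriv i (fun y ↦ f y * h y) x
      = D.frameDeriv i f x * h x + f x * D.frameDeriv i h x := by
  have := (mdifferentiableAt_of_contMDiff hf x).hasMFDerivAt.mul
    (mdifferentiableAt_of_contMDiff hh x).hasMFDerivAt
  have e : D.frameDeriv i (fun y ↦ f y * h y) x
      = f x * D.frameDeriv i h x + h x * D.frameDeriv i f x := by
    unfold frameDeriv
    rw [show (fun y ↦ f y * h y) = f * h from rfl, this.mfderiv]
    rfl
  rw [e]; ring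

theorem frameDeriv_clm (i : Fin 4) {F F' : Type*} [NormedAddCommGroup F] [NormedSpace ℝ F]
    [NormedAddCommGroup F'] [NormedSpace ℝ F'] (L : F →L[ℝ] F') {f : M → F}
    (hf : ContMDiff (𝓡 4) 𝓘(ℝ, F) ∞ f) (x : M) :
    mvfderiv (𝓡 4) (fun y ↦ L (f y)) x (D.frame i x) = L (mvfderiv (𝓡 4) f x (D.frame i x)) := by
  have h := (L.hasMFDerivAt (x := f x)).comp x (mdifferentiableAt_of_contMDiff hf x).hasMFDerivAt
  have := h.mfderiv
  unfold mvfderiv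
  change (mfderiv (𝓡 4) 𝓘(ℝ, F') (L ∘ f) x) (D.frame i x) = _
  rw [this]
  rfl

theorem frameDeriv_conj (i : Fin 4) (hf : ContMDiff (𝓡 4) 𝓘(ℝ, ℂ) ∞ f) (x : M) :
    D.frameDeriv i (fun y ↦ conj (f y)) x = conj (D.frameDeriv i f x) :=
  D.frameDeriv_clm i (Complex.conjCLE : ℂ →L[ℝ] ℂ) hf x

theorem frameDeriv_ofReal (i : Fin 4) {f : M → ℝ} (hf : ContMDiff (𝓡 4) 𝓘(ℝ, ℝ) ∞ f) (x : M) :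
    D.frameDeriv i (fun y ↦ (f y : ℂ)) x = (mvfderiv (𝓡 4) f x (D.frame i x) : ℝ) :=
  D.frameDeriv_clm i Complex.ofRealCLM hf x

theorem contMDiff_ofReal {f : M → ℝ} (hf : ContMDiff (𝓡 4) 𝓘(ℝ, ℝ) ∞ f) :
    ContMDiff (𝓡 4) 𝓘(ℝ, ℂ) ∞ (fun x ↦ (f x : ℂ)) :=
  Complex.ofRealCLM.contMDiff.comp hf

theorem contMDiff_conj (hf : ContMDiff (𝓡 4) 𝓘(ℝ, ℂ) ∞ f) :
    ContMDiff (𝓡 4) 𝓘(ℝ, ℂ) ∞ (fun x ↦ conj (f x)) :=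
  (Complex.conjCLE : ℂ →L[ℝ] ℂ).contMDiff.comp hf

theorem contMDiff_mul (hf : ContMDiff (𝓡 4) 𝓘(ℝ, ℂ) ∞ f) (hh : ContMDiff (𝓡 4) 𝓘(ℝ, ℂ) ∞ h) :
    ContMDiff (𝓡 4) 𝓘(ℝ, ℂ) ∞ (fun x ↦ f x * h x) := by
  have : ContDiff ℝ ∞ (fun p : ℂ × ℂ ↦ p.1 * p.2) := contDiff_mul
  exact this.contMDiff.comp (hf.prodMk_space hh)

theorem contMDiff_sum {ι : Type} {s : Finset ι} {F : ι → M → ℂ}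
    (hF : ∀ a, ContMDiff (𝓡 4) 𝓘(ℝ, ℂ) ∞ (F a)) :
    ContMDiff (𝓡 4) 𝓘(ℝ, ℂ) ∞ (fun x ↦ ∑ a ∈ s, F a x) := by
  classical
  induction s using Finset.induction_on with
  | empty => simpa using contMDiff_const
  | insert a s ha ih =>
    simp only [Finset.sum_insert ha]
    exact (hF a).add ih

theorem frameDeriv_sum (i : Fin 4) {ι : Type} {s : Finset ι} {F : ι → M → ℂ}
    (hF : ∀ a, ContMDiff (𝓡 4) 𝓘(ℝ, ℂ) ∞ (F a)) (x : M) :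
    D.frameDeriv i (fun y ↦ ∑ a ∈ s, F a y) x = ∑ a ∈ s, D.frameDeriv i (F a) x := by
  classical
  induction s using Finset.induction_on with
  | empty => simpa using D.frameDeriv_const i 0 x
  | insert a s ha ih =>
    simp only [Finset.sum_insert ha]
    rw [D.frameDeriv_add i (hF a) (contMDiff_sum hF), ih]

theorem contMDiff_const_mul (c : ℂ) (hf : ContMDiff (𝓡 4) 𝓘(ℝ, ℂ) ∞ f) :
    ContMDiff (𝓡 4) 𝓘(ℝ, ℂ) ∞ (fun x ↦ c * f x) :=
  contMDiff_mul contMDiff_const hf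

theorem frameDeriv_const_mul (i : Fin 4) (c : ℂ) (hf : ContMDiff (𝓡 4) 𝓘(ℝ, ℂ) ∞ f) (x : M) :
    D.frameDeriv i (fun y ↦ c * f y) x = c * D.frameDeriv i f x := by
  rw [D.frameDeriv_mul i contMDiff_const hf, frameDeriv_const]
  ring

theorem contMDiff_bracketCoeff (i j k : Fin 4) :
    ContMDiff (𝓡 4) 𝓘(ℝ, ℂ) ∞ (D.bracketCoeff i j k) :=
  contMDiff_ofReal (contMDiff_inner
    (contMDiff_mlieBracket (D.contMDiff_frame i) (D.contMDiff_frame j)) (D.contMDiff_frame k))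

theorem conj_bracketCoeff (i j k : Fin 4) (x : M) :
    conj (D.bracketCoeff i j k x) = D.bracketCoeff i j k x := Complex.conj_ofReal _

theorem bracketCoeff_swap (i j k : Fin 4) (x : M) :
    D.bracketCoeff j i k x = -D.bracketCoeff i j k x := by
  unfold bracketCoeff
  rw [VectorField.mlieBracket_swap_apply]
  simp

theorem mvfderiv_mlieBracket_frame (i j : Fin 4) {f : M → ℝ}
    (hf : ContMDiff (𝓡 4) 𝓘(ℝ, ℝ) ∞ f) (x : M) :
    mvfderiv (𝓡 4) (fun y ↦ mvfderiv (𝓡 4) f y (D.frame j y)) x (D.frame i x)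
        - mvfderiv (𝓡 4) (fun y ↦ mvfderiv (𝓡 4) f y (D.frame i y)) x (D.frame j x)
      = ∑ a, ∑ b, nullGramInv a b *
          (g.inner x (VectorField.mlieBracket (𝓡 4) (D.frame i) (D.frame j) x) (D.frame a x)
            * mvfderiv (𝓡 4) f x (D.frame b x)) := by
  have h := smul_left_injective ℝ ((D.linearIndependent_frame x).ne_zero 0)
    (mvfderiv_mlieBracket_smul hf (D.contMDiff_frame i) (D.contMDiff_frame j)
      (D.contMDiff_frame 0) x)
  rw [← h]
  conv_lhs => rw [D.eq_sum_frame x (VectorField.mlieBracket (𝓡 4) (D.frame i) (D.frame j) x)]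
  rw [map_sum, Finset.sum_comm]
  refine Finset.sum_congr rfl fun b _ ↦ ?_
  rw [map_smul, smul_eq_mul, Finset.sum_mul]
  exact Finset.sum_congr rfl fun a _ ↦ by ring

/-- The commutator of two frame derivations. -/
theorem frameDeriv_comm (i j : Fin 4) (hf : ContMDiff (𝓡 4) 𝓘(ℝ, ℂ) ∞ f) (x : M) :
    D.frameDeriv i (D.frameDeriv j f) x - D.frameDeriv j (D.frameDeriv i f) x
      = ∑ a, ∑ b, (nullGramInv a b : ℂ) * (D.bracketCoeff i j a x * D.frameDeriv b f x) := by
  have hd : ∀ (L : ℂ →L[ℝ] ℝ) (k l : Fin 4), L (D.frameDeriv k (D.frameDeriv l f) x)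
      = mvfderiv (𝓡 4) (fun y ↦ mvfderiv (𝓡 4) (fun z ↦ L (f z)) y (D.frame l y)) x
        (D.frame k x) := fun L k l ↦ by
    rw [show (fun y ↦ mvfderiv (𝓡 4) (fun z ↦ L (f z)) y (D.frame l y))
      = fun y ↦ L (D.frameDeriv l f y) from funext fun y ↦ D.frameDeriv_clm l L hf y]
    exact (D.frameDeriv_clm k L (D.contMDiff_frameDeriv l hf) x).symm
  have key : ∀ L : ℂ →L[ℝ] ℝ,
      L (D.frameDeriv i (D.frameDeriv j f) x - D.frameDeriv j (D.frameDeriv i f) x)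
      = L (∑ a, ∑ b, (nullGramInv a b : ℂ) * (D.bracketCoeff i j a x * D.frameDeriv b f x)) := by
    intro L
    have hLf : ContMDiff (𝓡 4) 𝓘(ℝ, ℝ) ∞ (fun z ↦ L (f z)) := L.contMDiff.comp hf
    rw [map_sub, hd, hd, D.mvfderiv_mlieBracket_frame i j hLf x, map_sum]
    refine Finset.sum_congr rfl fun a _ ↦ ?_
    rw [map_sum]
    refine Finset.sum_congr rfl fun b _ ↦ ?_
    have : mvfderiv (𝓡 4) (fun z ↦ L (f z)) x (D.frame b x) = L (D.frameDeriv b f x) :=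
      D.frameDeriv_clm b L hf x
    rw [this, bracketCoeff, ← Complex.real_smul, ← Complex.real_smul, map_smul, map_smul]
    rfl
  exact Complex.ext (key Complex.reCLM) (key Complex.imCLM)

theorem mlieBracket_sum_smul {ι : Type} (s : Finset ι) {c : ι → M → ℝ}
    (hc : ∀ a, ContMDiff (𝓡 4) 𝓘(ℝ, ℝ) ∞ (c a)) (V : (x : M) → TangentSpace (𝓡 4) x)
    {W : ι → (x : M) → TangentSpace (𝓡 4) x}
    (hW : ∀ a, ContMDiff (𝓡 4) (𝓡 4).tangent ∞ (fun x ↦ (⟨x, W a x⟩ : TangentBundle (𝓡 4) M)))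
    (x : M) :
    VectorField.mlieBracket (𝓡 4) V (∑ a ∈ s, c a • W a) x
      = ∑ a ∈ s, (mvfderiv (𝓡 4) (c a) x (V x) • W a x
          + c a x • VectorField.mlieBracket (𝓡 4) V (W a) x) := by
  classical
  have : IsManifold (𝓡 4) (minSmoothness ℝ 2) M := by
    simpa using (IsManifold.of_le (I := 𝓡 4) (M := M) (m := 2) (n := ∞) ENat.LEInfty.out)
  induction s using Finset.induction_on with
  | empty => simp
  | insert a s ha ih =>
    rw [Finset.sum_insert ha, Finset.sum_insert ha, ← ih, VectorField.mlieBracket_add_right,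
      VectorField.mlieBracket_smul_right (mdifferentiableAt_of_contMDiff (hc a) x)
        (mdifferentiableAt_section (hW a) x)]
    · exact mdifferentiableAt_section (contMDiff_smul_section (hc a) (hW a)) x
    · refine mdifferentiableAt_section ?_ x
      have := ContMDiff.sum_section (V := TangentSpace (𝓡 4)) (I := 𝓡 4) (n := ∞) (s := s)
        (t := fun a ↦ c a • W a) (fun a _ ↦ contMDiff_smul_section (hc a) (hW a))
      simpa only [Finset.sum_apply] using this

/-- `g([e_i, [e_j, e_k]], e_l)` in terms of the bracket coefficients. -/
theorem inner_mlieBracket_mlieBracket (i j k l : Fin 4) (x : M) :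
    ((g.inner x (VectorField.mlieBracket (𝓡 4) (D.frame i)
        (VectorField.mlieBracket (𝓡 4) (D.frame j) (D.frame k)) x) (D.frame l x) : ℝ) : ℂ)
      = D.frameDeriv i (D.bracketCoeff j k l) x
        + ∑ a, ∑ b, (nullGramInv a b : ℂ) *
          (D.bracketCoeff j k a x * D.bracketCoeff i b l x) := by
  have hβ : ∀ a, ContMDiff (𝓡 4) 𝓘(ℝ, ℝ) ∞ (fun x ↦
      g.inner x (VectorField.mlieBracket (𝓡 4) (D.frame j) (D.frame k) x) (D.frame a x)) :=
    fun a ↦ contMDiff_inner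
      (contMDiff_mlieBracket (D.contMDiff_frame j) (D.contMDiff_frame k)) (D.contMDiff_frame a)
  have hc : ∀ b, ContMDiff (𝓡 4) 𝓘(ℝ, ℝ) ∞ (fun x ↦ ∑ a, nullGramInv a b *
      g.inner x (VectorField.mlieBracket (𝓡 4) (D.frame j) (D.frame k) x) (D.frame a x)) :=
    fun b ↦ by
      simp only [Fin.sum_univ_four]
      exact (((contMDiff_const.mul (hβ 0)).add (contMDiff_const.mul (hβ 1))).add
        (contMDiff_const.mul (hβ 2))).add (contMDiff_const.mul (hβ 3))
  have hd : ∀ b, ((mvfderiv (𝓡 4) (fun x ↦ ∑ a, nullGramInv a b *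
      g.inner x (VectorField.mlieBracket (𝓡 4) (D.frame j) (D.frame k) x) (D.frame a x)) x
        (D.frame i x) : ℝ) : ℂ)
      = ∑ a, (nullGramInv a b : ℂ) * D.frameDeriv i (D.bracketCoeff j k a) x := fun b ↦ by
    rw [← D.frameDeriv_ofReal i (hc b) x]
    push_cast
    change D.frameDeriv i (fun y ↦ ∑ a, (nullGramInv a b : ℂ) * D.bracketCoeff j k a y) x = _
    rw [D.frameDeriv_sum i (fun a ↦ contMDiff_const_mul _ (D.contMDiff_bracketCoeff j k a))]
    exact Finset.sum_congr rfl fun a _ ↦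
      D.frameDeriv_const_mul i _ (D.contMDiff_bracketCoeff j k a) x
  rw [D.mlieBracket_frame j k, mlieBracket_sum_smul _ hc _ D.contMDiff_frame]
  simp only [map_sum, map_add, map_smul, FunLike.coe_sum, Finset.sum_apply, FunLike.coe_smul,
    Pi.smul_apply, FunLike.coe_add, Pi.add_apply, D.gram, smul_eq_mul]
  push_cast
  rw [Finset.sum_add_distrib]
  congr 1
  · simp only [hd]
    fin_cases l <;> simp [Fin.sum_univ_four, nullGram, nullGramInv] <;> ring
  · rw [Finset.sum_comm]
    refine Finset.sum_congr rfl fun b _ ↦ ?_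
    rw [Finset.sum_mul]
    exact Finset.sum_congr rfl fun a _ ↦ by unfold bracketCoeff; ring

/-- The Jacobi identity in the frame. -/
theorem jacobi_bracketCoeff (i j k l : Fin 4) (x : M) :
    (D.frameDeriv i (D.bracketCoeff j k l) x
        + ∑ a, ∑ b, (nullGramInv a b : ℂ) * (D.bracketCoeff j k a x * D.bracketCoeff i b l x))
      + (D.frameDeriv j (D.bracketCoeff k i l) x
        + ∑ a, ∑ b, (nullGramInv a b : ℂ) * (D.bracketCoeff k i a x * D.bracketCoeff j b l x))
      + (D.frameDeriv k (D.bracketCoeff i j l) x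
        + ∑ a, ∑ b, (nullGramInv a b : ℂ) * (D.bracketCoeff i j a x * D.bracketCoeff k b l x))
      = 0 := by
  have hneg : D.bracketCoeff k i l = fun y ↦ (-1) * D.bracketCoeff i k l y := by
    funext y
    rw [D.bracketCoeff_swap i k l y]
    ring
  have h2 : D.frameDeriv j (D.bracketCoeff k i l) x
        + ∑ a, ∑ b, (nullGramInv a b : ℂ) * (D.bracketCoeff k i a x * D.bracketCoeff j b l x)
      = -(D.frameDeriv j (D.bracketCoeff i k l) x
        + ∑ a, ∑ b, (nullGramInv a b : ℂ) *
          (D.bracketCoeff i k a x * D.bracketCoeff j b l x)) := by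
    rw [hneg, D.frameDeriv_const_mul j _ (D.contMDiff_bracketCoeff i k l)]
    simp only [fun a ↦ D.bracketCoeff_swap i k a x, neg_mul, mul_neg, Finset.sum_neg_distrib]
    ring
  have h := leibniz_mlieBracket (D.contMDiff_frame i) (D.contMDiff_frame j)
    (D.contMDiff_frame k) x
  rw [VectorField.mlieBracket_swap_apply (W := D.frame k)] at h
  rw [h2]
  simp only [← inner_mlieBracket_mlieBracket]
  rw [h]
  simp

/-! ### Symmetries of the Riemann tensor -/

theorem contMDiff_connCoeff (i j k : Fin 4) :
    ContMDiff (𝓡 4) 𝓘(ℝ, ℂ) ∞ (D.connCoeff i j k) := by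
  have h : D.connCoeff i j k = fun x ↦ (1 / 2 : ℂ) * (D.bracketCoeff i j k x
      + ((-1) * D.bracketCoeff i k j x + (-1) * D.bracketCoeff j k i x)) := by
    funext x
    unfold connCoeff
    ring
  rw [h]
  exact contMDiff_const_mul _ ((D.contMDiff_bracketCoeff i j k).add
    ((contMDiff_const_mul _ (D.contMDiff_bracketCoeff i k j)).add
      (contMDiff_const_mul _ (D.contMDiff_bracketCoeff j k i))))

theorem conj_connCoeff (i j k : Fin 4) (x : M) :
    conj (D.connCoeff i j k x) = D.connCoeff i j k x := by
  simp [connCoeff, conj_bracketCoeff, map_ofNat (starRingEnd ℂ) 2]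

theorem connCoeff_swap (i j k : Fin 4) (x : M) :
    D.connCoeff i k j x = -D.connCoeff i j k x := by
  unfold connCoeff
  rw [D.bracketCoeff_swap j k i x]
  ring

/-- The connection is torsion-free. -/
theorem connCoeff_sub_connCoeff (i j k : Fin 4) (x : M) :
    D.connCoeff i j k x - D.connCoeff j i k x = D.bracketCoeff i j k x := by
  unfold connCoeff
  rw [D.bracketCoeff_swap i j k x]
  ring

theorem frameDeriv_neg (i : Fin 4) {f : M → ℂ} (hf : ContMDiff (𝓡 4) 𝓘(ℝ, ℂ) ∞ f) (x : M) :
    D.frameDeriv i (fun y ↦ -f y) x = -D.frameDeriv i f x := by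
  have := D.frameDeriv_const_mul i (-1) hf x
  simpa using this

theorem frameDeriv_connCoeff_swap (i j k l : Fin 4) (x : M) :
    D.frameDeriv i (D.connCoeff j l k) x = -D.frameDeriv i (D.connCoeff j k l) x := by
  rw [← D.frameDeriv_neg i (D.contMDiff_connCoeff j k l)]
  congr 1
  funext y
  exact D.connCoeff_swap j k l y

theorem frameDeriv_connCoeff_sub (i j k l : Fin 4) (x : M) :
    D.frameDeriv i (D.bracketCoeff j k l) x
      = D.frameDeriv i (D.connCoeff j k l) x - D.frameDeriv i (D.connCoeff k j l) x := by
  have h : D.bracketCoeff j k l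
      = fun y ↦ D.connCoeff j k l y + (-1) * D.connCoeff k j l y := by
    funext y
    rw [← connCoeff_sub_connCoeff]
    ring
  rw [h, D.frameDeriv_add i (D.contMDiff_connCoeff j k l)
    (contMDiff_const_mul _ (D.contMDiff_connCoeff k j l)),
    D.frameDeriv_const_mul i _ (D.contMDiff_connCoeff k j l)]
  ring

theorem riemann_swap_left (i j k l : Fin 4) (x : M) :
    D.riemann j i k l x = -D.riemann i j k l x := by
  unfold riemann
  rw [neg_add, ← Finset.sum_neg_distrib]
  simp only [← Finset.sum_neg_distrib, fun a ↦ D.bracketCoeff_swap i j a x]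
  congr 1
  · ring
  · exact Finset.sum_congr rfl fun a _ ↦ Finset.sum_congr rfl fun b _ ↦ by ring

theorem nullGramInv_comm (a b : Fin 4) : nullGramInv a b = nullGramInv b a := by
  fin_cases a <;> fin_cases b <;> rfl

theorem riemann_swap_right (i j k l : Fin 4) (x : M) :
    D.riemann i j l k x = -D.riemann i j k l x := by
  have h : ∑ a, ∑ b, (nullGramInv a b : ℂ) *
        (D.connCoeff j l a x * D.connCoeff i b k x
          - D.connCoeff i l a x * D.connCoeff j b k x
          - D.bracketCoeff i j a x * D.connCoeff b l k x)
      = -∑ a, ∑ b, (nullGramInv a b : ℂ) *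
        (D.connCoeff j k a x * D.connCoeff i b l x
          - D.connCoeff i k a x * D.connCoeff j b l x
          - D.bracketCoeff i j a x * D.connCoeff b k l x) := by
    simp only [mul_sub, Finset.sum_sub_distrib]
    have e : ∀ p q : Fin 4, ∑ a, ∑ b, (nullGramInv a b : ℂ) *
        (D.connCoeff p l a x * D.connCoeff q b k x)
        = ∑ a, ∑ b, (nullGramInv a b : ℂ) *
        (D.connCoeff q k a x * D.connCoeff p b l x) := fun p q ↦ by
      rw [Finset.sum_comm]
      refine Finset.sum_congr rfl fun a _ ↦ Finset.sum_congr rfl fun b _ ↦ ?_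
      rw [nullGramInv_comm, D.connCoeff_swap p b l, D.connCoeff_swap q k a]
      ring
    rw [e j i, e i j]
    simp only [fun b ↦ D.connCoeff_swap b k l x, mul_neg, Finset.sum_neg_distrib]
    ring
  unfold riemann
  rw [h, D.frameDeriv_connCoeff_swap i j k l, D.frameDeriv_connCoeff_swap j i k l]
  ring

/-- The first Bianchi identity. -/
theorem riemann_bianchi (i j k l : Fin 4) (x : M) :
    D.riemann i j k l x + D.riemann j k i l x + D.riemann k i j l x = 0 := by
  rw [← D.jacobi_bracketCoeff i j k l x]
  unfold riemann
  simp only [frameDeriv_connCoeff_sub]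
  have h : ∀ p q r : Fin 4, ∑ a, ∑ b, (nullGramInv a b : ℂ) *
        (D.bracketCoeff q r a x * D.bracketCoeff p b l x)
      = ∑ a, ∑ b, (nullGramInv a b : ℂ) *
        ((D.connCoeff q r a x - D.connCoeff r q a x) * D.connCoeff p b l x
          - D.bracketCoeff q r a x * D.connCoeff b p l x) := fun p q r ↦
    Finset.sum_congr rfl fun a _ ↦ Finset.sum_congr rfl fun b _ ↦ by
      rw [D.connCoeff_sub_connCoeff q r a, ← D.connCoeff_sub_connCoeff p b l]
      ring
  rw [h i j k, h j k i, h k i j]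
  simp only [mul_sub, sub_mul, Finset.sum_sub_distrib]
  ring

theorem riemann_pair_symm (i j k l : Fin 4) (x : M) :
    D.riemann i j k l x = D.riemann k l i j x := by
  have h1 := D.riemann_bianchi i j k l x
  have h2 := D.riemann_bianchi j k l i x
  have h3 := D.riemann_bianchi k l i j x
  have h4 := D.riemann_bianchi l i j k x
  grind [D.riemann_swap_left, D.riemann_swap_right]

/-! ### Spinor form of the connection -/

theorem conj_solder (A A' : Fin 2) (i : Fin 4) : conj (solder A A' i) = solder A' A i := by
  fin_cases A <;> fin_cases A' <;> fin_cases i <;> simp [solder]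

/-- `g^{ab} = ε^{PQ} ε^{P'Q'} e_{PP'}^a e_{QQ'}^b`. -/
theorem nullGramInv_eq (a b : Fin 4) :
    (nullGramInv a b : ℂ) = ∑ P, ∑ Q, ∑ P', ∑ Q',
      spinEps P Q * spinEps P' Q' * (solder P P' a * solder Q Q' b) := by
  fin_cases a <;> fin_cases b <;>
    simp [nullGramInv, solder, spinEps, Fin.sum_univ_two] <;> ring

/-- Contraction with the inverse metric, in spinor components. -/
theorem sum_nullGramInv_mul (X Y : Fin 4 → ℂ) :
    ∑ a, ∑ b, (nullGramInv a b : ℂ) * (X a * Y b) = ∑ P, ∑ Q, ∑ P', ∑ Q',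
      spinEps P Q * spinEps P' Q' * ((∑ a, solder P P' a * X a) * ∑ b, solder Q Q' b * Y b) := by
  simp only [nullGramInv_eq, Fin.sum_univ_two, Fin.sum_univ_four]
  simp [spinEps]
  ring

theorem connSpinor_swap (A A' B B' C C' : Fin 2) (x : M) :
    D.connSpinor A A' C C' B B' x = -D.connSpinor A A' B B' C C' x := by
  unfold connSpinor
  rw [← Finset.sum_neg_distrib]
  refine Finset.sum_congr rfl fun i _ ↦ ?_
  rw [Finset.sum_comm, ← Finset.sum_neg_distrib]
  refine Finset.sum_congr rfl fun j _ ↦ ?_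
  rw [← Finset.sum_neg_distrib]
  refine Finset.sum_congr rfl fun k _ ↦ ?_
  rw [D.connCoeff_swap i j k]
  ring

theorem conj_connSpinor (A A' B B' C C' : Fin 2) (x : M) :
    conj (D.connSpinor A A' B B' C C' x) = D.connSpinor A' A B' B C' C x := by
  simp only [connSpinor, map_sum, map_mul, conj_solder, conj_connCoeff]

/-- The spin connection with both spinor indices lowered, `γ_{AA'BC} = Γ_{AA'B}^P ε_{PC}`. -/
def spinGamma (A A' B C : Fin 2) (x : M) : ℂ :=
  (1 / 2) * ∑ B', ∑ C', spinEps B' C' * D.connSpinor A A' B B' C C' x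

theorem spinConn_eq (A A' B C : Fin 2) (x : M) :
    D.spinConn A A' B C x = ∑ E, spinEps C E * D.spinGamma A A' B E x := by
  simp only [spinConn, spinGamma, Fin.sum_univ_two]
  ring

theorem spinGamma_swap (A A' B C : Fin 2) (x : M) :
    D.spinGamma A A' C B x = D.spinGamma A A' B C x := by
  simp only [spinGamma, Fin.sum_univ_two, fun X Y ↦ D.connSpinor_swap A A' B X C Y x]
  simp [spinEps, add_comm]

/-- `∇_{AA'} e_{BB'}` splits into the spin connection and its conjugate. -/
theorem connSpinor_eq (A A' B B' C C' : Fin 2) (x : M) :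
    D.connSpinor A A' B B' C C' x = D.spinGamma A A' B C x * spinEps B' C'
      + conj (D.spinGamma A' A B' C' x) * spinEps B C := by
  have h : ∀ P P', D.connSpinor A A' P P' P P' x = 0 := fun P P' ↦
    self_eq_neg.mp (D.connSpinor_swap A A' P P' P P' x)
  have s := fun P P' Q Q' ↦ D.connSpinor_swap A A' P P' Q Q' x
  have s1 := s 0 0 0 1
  have s2 := s 0 0 1 0
  have s3 := s 0 0 1 1
  have s4 := s 0 1 1 0
  have s5 := s 0 1 1 1
  have s6 := s 1 0 1 1
  simp only [spinGamma, map_mul, map_add, conj_connSpinor, Fin.sum_univ_two]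
  fin_cases B <;> fin_cases B' <;> fin_cases C <;> fin_cases C' <;>
    simp [spinEps, h, s1, s2, s3, s4, s5, s6, map_ofNat (starRingEnd ℂ) 2] <;> ring

/-! ### Spinor form of the curvature -/

theorem sum_mul_sum_comm {ι κ : Type*} [Fintype ι] [Fintype κ] (u : ι → ℂ) (v : κ → ℂ)
    (X : ι → κ → ℂ) :
    ∑ i, u i * ∑ j, v j * X i j = ∑ j, v j * ∑ i, u i * X i j := by
  simp only [Finset.mul_sum]
  rw [Finset.sum_comm]
  exact Finset.sum_congr rfl fun j _ ↦ Finset.sum_congr rfl fun i _ ↦ by ring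

theorem sum_mul_contract_left {ι κ : Type*} [Fintype ι] [Fintype κ] (η : κ → κ → ℂ) (u : ι → ℂ)
    (X : ι → κ → ℂ) (Y : κ → ℂ) :
    ∑ i, u i * ∑ a, ∑ b, η a b * (X i a * Y b)
      = ∑ a, ∑ b, η a b * ((∑ i, u i * X i a) * Y b) := by
  simp only [Finset.mul_sum, Finset.sum_mul]
  rw [Finset.sum_comm]
  refine Finset.sum_congr rfl fun a _ ↦ ?_
  rw [Finset.sum_comm]
  exact Finset.sum_congr rfl fun b _ ↦ Finset.sum_congr rfl fun i _ ↦ by ring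

theorem sum_mul_contract_right {ι κ : Type*} [Fintype ι] [Fintype κ] (η : κ → κ → ℂ) (u : ι → ℂ)
    (X : κ → ℂ) (Y : ι → κ → ℂ) :
    ∑ i, u i * ∑ a, ∑ b, η a b * (X a * Y i b)
      = ∑ a, ∑ b, η a b * (X a * ∑ i, u i * Y i b) := by
  simp only [Finset.mul_sum]
  rw [Finset.sum_comm]
  refine Finset.sum_congr rfl fun a _ ↦ ?_
  rw [Finset.sum_comm]
  exact Finset.sum_congr rfl fun b _ ↦ Finset.sum_congr rfl fun i _ ↦ by ring

theorem connSpinor_eq_nested (A A' B B' C C' : Fin 2) (x : M) :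
    D.connSpinor A A' B B' C C' x
      = ∑ i, solder A A' i * ∑ j, solder B B' j * ∑ k, solder C C' k * D.connCoeff i j k x := by
  simp only [connSpinor, Finset.mul_sum, mul_assoc]

theorem contMDiff_connSpinor (A A' B B' C C' : Fin 2) :
    ContMDiff (𝓡 4) 𝓘(ℝ, ℂ) ∞ (D.connSpinor A A' B B' C C') := by
  rw [funext (D.connSpinor_eq_nested A A' B B' C C')]
  exact contMDiff_sum fun i ↦ contMDiff_const_mul _ <| contMDiff_sum fun j ↦
    contMDiff_const_mul _ <| contMDiff_sum fun k ↦ contMDiff_const_mul _ <|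
      D.contMDiff_connCoeff i j k

theorem frameDeriv_sum_const_mul (i : Fin 4) {ι : Type} [Fintype ι] (c : ι → ℂ) {F : ι → M → ℂ}
    (hF : ∀ a, ContMDiff (𝓡 4) 𝓘(ℝ, ℂ) ∞ (F a)) (x : M) :
    D.frameDeriv i (fun y ↦ ∑ a, c a * F a y) x = ∑ a, c a * D.frameDeriv i (F a) x := by
  rw [D.frameDeriv_sum i fun a ↦ contMDiff_const_mul _ (hF a)]
  exact Finset.sum_congr rfl fun a _ ↦ D.frameDeriv_const_mul i _ (hF a) x

theorem partialD_connSpinor (A A' B B' C C' E E' : Fin 2) (x : M) :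
    D.partialD A A' (D.connSpinor B B' C C' E E') x
      = ∑ i, solder A A' i * ∑ j, solder B B' j * ∑ k, solder C C' k * ∑ l, solder E E' l *
          D.frameDeriv i (D.connCoeff j k l) x := by
  have h1 : ∀ j k, ContMDiff (𝓡 4) 𝓘(ℝ, ℂ) ∞
      (fun y ↦ ∑ l, solder E E' l * D.connCoeff j k l y) := fun j k ↦
    contMDiff_sum fun l ↦ contMDiff_const_mul _ <| D.contMDiff_connCoeff j k l
  have h2 : ∀ j, ContMDiff (𝓡 4) 𝓘(ℝ, ℂ) ∞
      (fun y ↦ ∑ k, solder C C' k * ∑ l, solder E E' l * D.connCoeff j k l y) := fun j ↦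
    contMDiff_sum fun k ↦ contMDiff_const_mul _ <| h1 j k
  unfold partialD
  rw [funext (D.connSpinor_eq_nested B B' C C' E E')]
  simp only [D.frameDeriv_sum_const_mul _ _ h2, D.frameDeriv_sum_const_mul _ _ (h1 _),
    D.frameDeriv_sum_const_mul _ _ (D.contMDiff_connCoeff _ _)]

theorem riemannSpinor_eq_nested (A A' B B' C C' E E' : Fin 2) (x : M) :
    D.riemannSpinor A A' B B' C C' E E' x
      = ∑ i, solder A A' i * ∑ j, solder B B' j * ∑ k, solder C C' k * ∑ l, solder E E' l *
          D.riemann i j k l x := by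
  simp only [riemannSpinor, Finset.mul_sum, mul_assoc]

theorem sum_solder_connCoeff (A A' B B' P P' : Fin 2) (x : M) :
    ∑ a, solder P P' a * ∑ i, solder A A' i * ∑ j, solder B B' j * D.connCoeff i j a x
      = D.connSpinor A A' B B' P P' x := by
  rw [connSpinor_eq_nested, sum_mul_sum_comm]
  exact Finset.sum_congr rfl fun i _ ↦ by rw [sum_mul_sum_comm]

theorem sum_solder_bracketCoeff (A A' B B' P P' : Fin 2) (x : M) :
    ∑ a, solder P P' a * ∑ i, solder A A' i * ∑ j, solder B B' j * D.bracketCoeff i j a x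
      = D.connSpinor A A' B B' P P' x - D.connSpinor B B' A A' P P' x := by
  rw [← sum_solder_connCoeff, ← sum_solder_connCoeff]
  simp only [← connCoeff_sub_connCoeff, mul_sub, Finset.sum_sub_distrib]
  congr 1
  exact Finset.sum_congr rfl fun a _ ↦ by rw [sum_mul_sum_comm]

/-- The Riemann tensor in spinor components. -/
theorem riemannSpinor_eq (A A' B B' C C' E E' : Fin 2) (x : M) :
    D.riemannSpinor A A' B B' C C' E E' x
      = D.partialD A A' (D.connSpinor B B' C C' E E') x
        - D.partialD B B' (D.connSpinor A A' C C' E E') x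
        + ∑ P, ∑ Q, ∑ P', ∑ Q', spinEps P Q * spinEps P' Q' *
          (D.connSpinor B B' C C' P P' x * D.connSpinor A A' Q Q' E E' x
            - D.connSpinor A A' C C' P P' x * D.connSpinor B B' Q Q' E E' x
            - (D.connSpinor A A' B B' P P' x - D.connSpinor B B' A A' P P' x)
              * D.connSpinor Q Q' C C' E E' x) := by
  have hG' : ∀ X X' Y Y' Q Q', ∑ b, solder Q Q' b * ∑ i, solder X X' i * ∑ l, solder Y Y' l *
      D.connCoeff i b l x = D.connSpinor X X' Q Q' Y Y' x := fun X X' Y Y' Q Q' ↦ by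
    rw [connSpinor_eq_nested, sum_mul_sum_comm]
  have q : ∀ X X' Y Y' : Fin 2, ∑ j, solder Y Y' j * ∑ k, solder C C' k * ∑ l, solder E E' l *
        ∑ a, ∑ b, (nullGramInv a b : ℂ) * (D.connCoeff j k a x *
          ∑ i, solder X X' i * D.connCoeff i b l x)
      = ∑ P, ∑ Q, ∑ P', ∑ Q', spinEps P Q * spinEps P' Q' *
        (D.connSpinor Y Y' C C' P P' x * D.connSpinor X X' Q Q' E E' x) := fun X X' Y Y' ↦ by
    simp only [sum_mul_contract_right, sum_mul_contract_left]
    rw [sum_nullGramInv_mul]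
    simp only [sum_solder_connCoeff, sum_mul_sum_comm (solder E E'), hG']
  have q1 : ∑ i, solder A A' i * ∑ j, solder B B' j * ∑ k, solder C C' k * ∑ l, solder E E' l *
        ∑ a, ∑ b, (nullGramInv a b : ℂ) * (D.connCoeff j k a x * D.connCoeff i b l x)
      = ∑ P, ∑ Q, ∑ P', ∑ Q', spinEps P Q * spinEps P' Q' *
        (D.connSpinor B B' C C' P P' x * D.connSpinor A A' Q Q' E E' x) := by
    rw [← q]
    simp only [sum_mul_contract_right, sum_mul_contract_left, sum_mul_sum_comm (solder E E')]
  have q2 : ∑ i, solder A A' i * ∑ j, solder B B' j * ∑ k, solder C C' k * ∑ l, solder E E' l *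
        ∑ a, ∑ b, (nullGramInv a b : ℂ) * (D.connCoeff i k a x * D.connCoeff j b l x)
      = ∑ P, ∑ Q, ∑ P', ∑ Q', spinEps P Q * spinEps P' Q' *
        (D.connSpinor A A' C C' P P' x * D.connSpinor B B' Q Q' E E' x) := by
    rw [← q, sum_mul_sum_comm]
    simp only [sum_mul_contract_right, sum_mul_contract_left, sum_mul_sum_comm (solder E E')]
  have q3 : ∑ i, solder A A' i * ∑ j, solder B B' j * ∑ k, solder C C' k * ∑ l, solder E E' l *
        ∑ a, ∑ b, (nullGramInv a b : ℂ) * (D.bracketCoeff i j a x * D.connCoeff b k l x)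
      = ∑ P, ∑ Q, ∑ P', ∑ Q', spinEps P Q * spinEps P' Q' *
        ((D.connSpinor A A' B B' P P' x - D.connSpinor B B' A A' P P' x)
          * D.connSpinor Q Q' C C' E E' x) := by
    simp only [sum_mul_contract_right, sum_mul_contract_left]
    rw [sum_nullGramInv_mul]
    simp only [sum_solder_bracketCoeff, ← connSpinor_eq_nested]
  rw [riemannSpinor_eq_nested, partialD_connSpinor, partialD_connSpinor,
    sum_mul_sum_comm (solder B B') (solder A A')]
  simp only [riemann]
  simp only [mul_add, mul_sub, Finset.sum_add_distrib, Finset.sum_sub_distrib]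
  rw [q1, q2, q3]

/-! ### The derivations `partialD` -/

section PartialD

variable {f h : M → ℂ}

theorem contMDiff_partialD (A A' : Fin 2) (hf : ContMDiff (𝓡 4) 𝓘(ℝ, ℂ) ∞ f) :
    ContMDiff (𝓡 4) 𝓘(ℝ, ℂ) ∞ (D.partialD A A' f) :=
  contMDiff_sum fun i ↦ contMDiff_const_mul _ (D.contMDiff_frameDeriv i hf)

theorem partialD_const (A A' : Fin 2) (c : ℂ) (x : M) : D.partialD A A' (fun _ ↦ c) x = 0 := by
  simp [partialD, frameDeriv_const]

theorem partialD_add (A A' : Fin 2) (hf : ContMDiff (𝓡 4) 𝓘(ℝ, ℂ) ∞ f)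
    (hh : ContMDiff (𝓡 4) 𝓘(ℝ, ℂ) ∞ h) (x : M) :
    D.partialD A A' (fun y ↦ f y + h y) x = D.partialD A A' f x + D.partialD A A' h x := by
  simp only [partialD, D.frameDeriv_add _ hf hh, mul_add, Finset.sum_add_distrib]

theorem partialD_mul (A A' : Fin 2) (hf : ContMDiff (𝓡 4) 𝓘(ℝ, ℂ) ∞ f)
    (hh : ContMDiff (𝓡 4) 𝓘(ℝ, ℂ) ∞ h) (x : M) :
    D.partialD A A' (fun y ↦ f y * h y) x
      = D.partialD A A' f x * h x + f x * D.partialD A A' h x := by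
  simp only [partialD, D.frameDeriv_mul _ hf hh, mul_add, Finset.sum_add_distrib, Finset.sum_mul,
    Finset.mul_sum]
  congr 1 <;> exact Finset.sum_congr rfl fun i _ ↦ by ring

theorem partialD_const_mul (A A' : Fin 2) (c : ℂ) (hf : ContMDiff (𝓡 4) 𝓘(ℝ, ℂ) ∞ f) (x : M) :
    D.partialD A A' (fun y ↦ c * f y) x = c * D.partialD A A' f x := by
  rw [D.partialD_mul A A' contMDiff_const hf, partialD_const]
  ring

theorem partialD_neg (A A' : Fin 2) (hf : ContMDiff (𝓡 4) 𝓘(ℝ, ℂ) ∞ f) (x : M) :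
    D.partialD A A' (fun y ↦ -f y) x = -D.partialD A A' f x := by
  have := D.partialD_const_mul A A' (-1) hf x
  simpa using this

theorem partialD_sum (A A' : Fin 2) {ι : Type} {s : Finset ι} {F : ι → M → ℂ}
    (hF : ∀ a, ContMDiff (𝓡 4) 𝓘(ℝ, ℂ) ∞ (F a)) (x : M) :
    D.partialD A A' (fun y ↦ ∑ a ∈ s, F a y) x = ∑ a ∈ s, D.partialD A A' (F a) x := by
  simp only [partialD, D.frameDeriv_sum _ hF, Finset.mul_sum]
  rw [Finset.sum_comm]

theorem partialD_conj (A A' : Fin 2) (hf : ContMDiff (𝓡 4) 𝓘(ℝ, ℂ) ∞ f) (x : M) :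
    D.partialD A A' (fun y ↦ conj (f y)) x = conj (D.partialD A' A f x) := by
  simp only [partialD, D.frameDeriv_conj _ hf, map_sum, map_mul, conj_solder]

/-- The commutator of `∂_{AA'}` and `∂_{BB'}`. -/
theorem partialD_comm (A A' B B' : Fin 2) (hf : ContMDiff (𝓡 4) 𝓘(ℝ, ℂ) ∞ f) (x : M) :
    D.partialD A A' (D.partialD B B' f) x - D.partialD B B' (D.partialD A A' f) x
      = ∑ P, ∑ Q, ∑ P', ∑ Q', spinEps P Q * spinEps P' Q' *
        ((D.connSpinor A A' B B' P P' x - D.connSpinor B B' A A' P P' x)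
          * D.partialD Q Q' f x) := by
  have h : ∀ X X' Y Y', D.partialD X X' (D.partialD Y Y' f) x
      = ∑ i, solder X X' i * ∑ j, solder Y Y' j * D.frameDeriv i (D.frameDeriv j f) x :=
    fun X X' Y Y' ↦ Finset.sum_congr rfl fun i _ ↦ by
      unfold partialD
      rw [D.frameDeriv_sum_const_mul i _ fun j ↦ D.contMDiff_frameDeriv j hf]
  rw [h, h, sum_mul_sum_comm (solder B B')]
  simp only [← Finset.sum_sub_distrib, ← mul_sub, D.frameDeriv_comm _ _ hf]
  simp only [sum_mul_contract_left]
  rw [sum_nullGramInv_mul]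
  simp only [sum_solder_bracketCoeff]
  rfl

end PartialD

/-! ### Curvature of the spin connection -/

theorem contMDiff_spinGamma (A A' B C : Fin 2) :
    ContMDiff (𝓡 4) 𝓘(ℝ, ℂ) ∞ (D.spinGamma A A' B C) :=
  contMDiff_const_mul _ <| contMDiff_sum fun _ ↦ contMDiff_sum fun _ ↦
    contMDiff_const_mul _ <| D.contMDiff_connSpinor _ _ _ _ _ _

theorem partialD_spinGamma (A A' B B' C E : Fin 2) (x : M) :
    D.partialD A A' (D.spinGamma B B' C E) x = (1 / 2) * ∑ C', ∑ E', spinEps C' E' *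
      D.partialD A A' (D.connSpinor B B' C C' E E') x := by
  unfold spinGamma
  have h : ∀ C' E', ContMDiff (𝓡 4) 𝓘(ℝ, ℂ) ∞
      (fun y ↦ spinEps C' E' * D.connSpinor B B' C C' E E' y) := fun C' E' ↦
    contMDiff_const_mul _ <| D.contMDiff_connSpinor B B' C C' E E'
  rw [D.partialD_const_mul A A' _ (contMDiff_sum fun C' ↦ contMDiff_sum fun E' ↦ h C' E'),
    D.partialD_sum A A' (fun C' ↦ contMDiff_sum fun E' ↦ h C' E')]
  simp only [D.partialD_sum A A' (h _),
    D.partialD_const_mul A A' _ (D.contMDiff_connSpinor B B' C _ E _)]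

/-- The curvature `½ R_{AA'BB'CC'E}^{C'}` of the spin connection, with lowered indices. -/
def spinCurv (A A' B B' C E : Fin 2) (x : M) : ℂ :=
  (1 / 2) * ∑ C', ∑ E', spinEps C' E' * D.riemannSpinor A A' B B' C C' E E' x

/-- The primed part of the connection does not contribute to the quadratic part of the curvature
of the unprimed spin connection. -/
theorem sum_spinEps_quadratic (a b a' b' : Fin 2 → Fin 2 → ℂ)
    (ha : ∀ P Q, a P Q = a Q P) (hb : ∀ P Q, b P Q = b Q P)
    (ha' : ∀ P Q, a' P Q = a' Q P) (hb' : ∀ P Q, b' P Q = b' Q P) (C E : Fin 2) :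
    (1 / 2) * ∑ C', ∑ E', spinEps C' E' * ∑ P, ∑ Q, ∑ P', ∑ Q', spinEps P Q * spinEps P' Q' *
        ((b C P * spinEps C' P' + b' C' P' * spinEps C P)
            * (a Q E * spinEps Q' E' + a' Q' E' * spinEps Q E)
          - (a C P * spinEps C' P' + a' C' P' * spinEps C P)
            * (b Q E * spinEps Q' E' + b' Q' E' * spinEps Q E))
      = ∑ P, ∑ Q, spinEps P Q * (a C P * b Q E - b C P * a Q E) := by
  have h1 := ha 1 0
  have h2 := hb 1 0
  have h3 := ha' 1 0
  have h4 := hb' 1 0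
  simp only [Fin.sum_univ_two]
  fin_cases C <;> fin_cases E <;> simp [spinEps, h1, h2, h3, h4] <;> ring

theorem spinCurv_eq (A A' B B' C E : Fin 2) (x : M) :
    D.spinCurv A A' B B' C E x
      = D.partialD A A' (D.spinGamma B B' C E) x - D.partialD B B' (D.spinGamma A A' C E) x
        + ∑ P, ∑ Q, spinEps P Q * (D.spinGamma A A' C P x * D.spinGamma B B' Q E x
          - D.spinGamma B B' C P x * D.spinGamma A A' Q E x)
        - ∑ P, ∑ Q, ∑ P', ∑ Q', spinEps P Q * spinEps P' Q' *
          ((D.connSpinor A A' B B' P P' x - D.connSpinor B B' A A' P P' x)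
            * D.spinGamma Q Q' C E x) := by
  rw [← sum_spinEps_quadratic (fun P Q ↦ D.spinGamma A A' P Q x)
    (fun P Q ↦ D.spinGamma B B' P Q x) (fun P Q ↦ conj (D.spinGamma A' A P Q x))
    (fun P Q ↦ conj (D.spinGamma B' B P Q x)) (fun P Q ↦ D.spinGamma_swap A A' Q P x)
    (fun P Q ↦ D.spinGamma_swap B B' Q P x)
    (fun P Q ↦ congrArg conj (D.spinGamma_swap A' A Q P x))
    (fun P Q ↦ congrArg conj (D.spinGamma_swap B' B Q P x))]
  simp only [← connSpinor_eq]
  rw [partialD_spinGamma, partialD_spinGamma]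
  simp only [spinCurv, riemannSpinor_eq]
  have hγ : ∀ Q Q', D.spinGamma Q Q' C E x
      = (1 / 2) * ∑ C', ∑ E', spinEps C' E' * D.connSpinor Q Q' C C' E E' x := fun _ _ ↦ rfl
  simp only [hγ]
  simp only [spinEps, Fin.sum_univ_two]
  simp
  ring

/-! ### Symmetries of the curvature spinors -/

theorem riemannSpinor_swap_left (A A' B B' C C' E E' : Fin 2) (x : M) :
    D.riemannSpinor B B' A A' C C' E E' x = -D.riemannSpinor A A' B B' C C' E E' x := by
  rw [riemannSpinor_eq_nested, riemannSpinor_eq_nested, sum_mul_sum_comm]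
  simp only [← Finset.sum_neg_distrib, ← mul_neg, ← riemann_swap_left]

theorem riemannSpinor_pair_symm (A A' B B' C C' E E' : Fin 2) (x : M) :
    D.riemannSpinor A A' B B' C C' E E' x = D.riemannSpinor C C' E E' A A' B B' x := by
  have h3 : ∀ F : Fin 4 → Fin 4 → Fin 4 → ℂ,
      ∑ i, ∑ j, ∑ k, F i j k = ∑ k, ∑ i, ∑ j, F i j k := fun F ↦ by
    exact (Finset.sum_congr rfl fun i _ ↦ Finset.sum_comm).trans Finset.sum_comm
  unfold riemannSpinor
  rw [h3]
  refine Finset.sum_congr rfl fun k _ ↦ ?_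
  rw [h3]
  refine Finset.sum_congr rfl fun l _ ↦ Finset.sum_congr rfl fun i _ ↦
    Finset.sum_congr rfl fun j _ ↦ ?_
  rw [D.riemann_pair_symm i j k l]
  ring

theorem conj_riemann (i j k l : Fin 4) (x : M) :
    conj (D.riemann i j k l x) = D.riemann i j k l x := by
  have h : ∀ p q r s, conj (D.frameDeriv p (D.connCoeff q r s) x)
      = D.frameDeriv p (D.connCoeff q r s) x := fun p q r s ↦ by
    rw [← D.frameDeriv_conj p (D.contMDiff_connCoeff q r s)]
    simp only [conj_connCoeff]
  simp only [riemann, map_add, map_sub, map_sum, map_mul, h, conj_connCoeff, conj_bracketCoeff,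
    Complex.conj_ofReal]

theorem conj_riemannSpinor (A A' B B' C C' E E' : Fin 2) (x : M) :
    conj (D.riemannSpinor A A' B B' C C' E E' x) = D.riemannSpinor A' A B' B C' C E' E x := by
  simp only [riemannSpinor, map_sum, map_mul, conj_solder, conj_riemann]

theorem spinCurv_swap_left (A A' B B' C E : Fin 2) (x : M) :
    D.spinCurv B B' A A' C E x = -D.spinCurv A A' B B' C E x := by
  simp only [spinCurv, fun C' E' ↦ D.riemannSpinor_swap_left A A' B B' C C' E E' x, mul_neg,
    Finset.sum_neg_distrib]

theorem conj_spinEps (A B : Fin 2) : conj (spinEps A B) = spinEps A B := by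
  fin_cases A <;> fin_cases B <;> simp [spinEps]

/-- The tracefree Ricci spinor is Hermitian. -/
theorem sum_spinEps_spinCurv (A' B' C E : Fin 2) (x : M) :
    ∑ A, ∑ B, spinEps A B * D.spinCurv A A' B B' C E x
      = ∑ C', ∑ E', spinEps C' E' * conj (D.spinCurv C' C E' E A' B' x) := by
  simp only [spinCurv, map_mul, map_sum, conj_spinEps, conj_riemannSpinor,
    fun A B C' E' ↦ D.riemannSpinor_pair_symm A A' B B' C C' E E' x]
  simp only [Fin.sum_univ_two]
  simp [spinEps, map_ofNat (starRingEnd ℂ) 2]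
  ring

/-- `X_ABCD` as a function of four separate indices. -/
def curvX (A B C E : Fin 2) (x : M) : ℂ := D.curvSpinor ![A, B, C, E] x

theorem curvSpinor_eq (I : Fin 4 → Fin 2) (x : M) :
    D.curvSpinor I x = D.curvX (I 0) (I 1) (I 2) (I 3) x := rfl

theorem curvX_eq (A B C E : Fin 2) (x : M) :
    D.curvX A B C E x = (1 / 2) * ∑ A', ∑ B', spinEps A' B' * D.spinCurv A A' B B' C E x := by
  simp only [curvX, curvSpinor, spinCurv, Fin.sum_univ_two]
  simp [spinEps]
  ring

theorem curvX_swap_left (A B C E : Fin 2) (x : M) : D.curvX B A C E x = D.curvX A B C E x := by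
  simp only [curvX_eq, Fin.sum_univ_two, fun A' B' ↦ D.spinCurv_swap_left A A' B B' C E x]
  simp [spinEps, add_comm]

theorem curvX_pair_symm (A B C E : Fin 2) (x : M) : D.curvX A B C E x = D.curvX C E A B x := by
  simp only [curvX_eq, spinCurv, fun A' B' C' E' ↦ D.riemannSpinor_pair_symm A A' B B' C C' E E' x,
    Fin.sum_univ_two]
  simp [spinEps]
  ring

theorem weylSpinor_zero (x : M) : D.weylSpinor 0 0 0 0 x = D.curvX 0 0 0 0 x := by
  have h : ∀ s : Equiv.Perm (Fin 4),
      D.curvSpinor (fun i ↦ ![0, 0, 0, 0] (s i)) x = D.curvX 0 0 0 0 x := fun s ↦ by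
    have : ∀ i : Fin 4, (![0, 0, 0, 0] : Fin 4 → Fin 2) i = 0 := by decide
    simp only [curvSpinor_eq, this]
  unfold weylSpinor
  rw [Finset.sum_congr rfl fun s _ ↦ h s, Finset.sum_const, Finset.card_univ, Fintype.card_perm]
  simp [Nat.factorial]

theorem weylSpinor_one (x : M) : D.weylSpinor 1 0 0 0 x = D.curvX 0 1 0 0 x := by
  have h : ∀ s : Equiv.Perm (Fin 4),
      D.curvSpinor (fun i ↦ ![1, 0, 0, 0] (s i)) x = D.curvX 0 1 0 0 x := fun s ↦ by
    have hs : ∀ i, (![1, 0, 0, 0] : Fin 4 → Fin 2) (s i) = if i = s.symm 0 then 1 else 0 :=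
      fun i ↦ by
        simp only [Equiv.eq_symm_apply]
        generalize s i = j
        revert j
        decide
    simp only [curvSpinor_eq, hs]
    generalize s.symm 0 = j
    fin_cases j
    · exact D.curvX_swap_left 0 1 0 0 x
    · rfl
    · exact (D.curvX_pair_symm 0 0 1 0 x).trans (D.curvX_swap_left 0 1 0 0 x)
    · exact D.curvX_pair_symm 0 0 0 1 x
  unfold weylSpinor
  rw [Finset.sum_congr rfl fun s _ ↦ h s, Finset.sum_const, Finset.card_univ, Fintype.card_perm]
  simp [Nat.factorial]

theorem isRepeatedPrincipal_iff :
    D.IsRepeatedPrincipal ↔ ∀ x, D.curvX 0 0 0 0 x = 0 ∧ D.curvX 0 1 0 0 x = 0 := by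
  have h : ∀ A x, ∑ B, ∑ C, ∑ E, D.weylSpinor A B C E x * spinO B * spinO C * spinO E
      = D.weylSpinor A 0 0 0 x := fun A x ↦ by
    simp [Fin.sum_univ_two, spinO]
  unfold IsRepeatedPrincipal
  simp only [h, Fin.forall_fin_two, weylSpinor_zero, weylSpinor_one]
  exact forall_and.symm

/-! ### Structure equations along a shear-free ray -/

/-- A ray is shear-free iff the components `κ` and `σ` of the spin connection vanish. -/
theorem isShearFreeRay_iff : D.IsShearFreeRay ↔ ∀ A' x, D.spinGamma 0 A' 0 0 x = 0 := by
  have h : ∀ A' x, ∑ A, ∑ B, spinO A * spinO B * D.nablaLower spinO A A' B x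
      = D.spinGamma 0 A' 0 0 x := fun A' x ↦ by
    simp [nablaLower, nabla, Fin.sum_univ_two, spinO, indexConn, spinConn_eq, spinEps, spinLower,
      partialD_const]
  unfold IsShearFreeRay
  simp only [h]

/-- The coefficients of the commutator `[o^A ∂_{A0'}, o^A ∂_{A1'}]` in terms of the
`o^A ∂_{AC'}`, for a shear-free ray `o^A`. -/
def rayBracket : Fin 2 → M → ℂ :=
  ![fun x ↦ conj (D.spinGamma 0 0 1 1 x) - D.spinGamma 0 1 0 1 x - conj (D.spinGamma 1 0 0 1 x),
    fun x ↦ D.spinGamma 0 0 0 1 x - conj (D.spinGamma 0 0 0 1 x) + conj (D.spinGamma 1 0 0 0 x)]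

theorem partialD_shear (hκ : ∀ A' x, D.spinGamma 0 A' 0 0 x = 0)
    (A A' B' : Fin 2) (x : M) : D.partialD A A' (D.spinGamma 0 B' 0 0) x = 0 := by
  rw [show D.spinGamma 0 B' 0 0 = fun _ ↦ 0 from funext (hκ B')]
  exact D.partialD_const A A' 0 x

theorem partialD_comm_ray (hκ : ∀ A' x, D.spinGamma 0 A' 0 0 x = 0)
    {f : M → ℂ} (hf : ContMDiff (𝓡 4) 𝓘(ℝ, ℂ) ∞ f) (x : M) :
    D.partialD 0 0 (D.partialD 0 1 f) x - D.partialD 0 1 (D.partialD 0 0 f) x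
      = ∑ C, D.rayBracket C x * D.partialD 0 C f x := by
  have h := fun A A' ↦ D.spinGamma_swap A A' 0 1 x
  rw [D.partialD_comm 0 0 0 1 hf]
  simp only [connSpinor_eq, Fin.sum_univ_two]
  simp [spinEps, rayBracket, hκ, h]
  ring

theorem curvX_zero (hκ : ∀ A' x, D.spinGamma 0 A' 0 0 x = 0) (x : M) : D.curvX 0 0 0 0 x = 0 := by
  simp only [curvX_eq, spinCurv_eq, connSpinor_eq, Fin.sum_univ_two, D.partialD_shear hκ]
  simp [spinEps, hκ]

/-- The curl of a one-form along the surface elements spanned by `o^A ∂_{AA'}`. -/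
def rayCurl (h : Fin 2 → M → ℂ) (x : M) : ℂ :=
  D.partialD 0 0 (h 1) x - D.partialD 0 1 (h 0) x - ∑ C, D.rayBracket C x * h C x

/-- The curl of `(ρ, τ)`. -/
theorem rayCurl_rho_tau (hκ : ∀ A' x, D.spinGamma 0 A' 0 0 x = 0) (x : M) :
    D.rayCurl (fun C ↦ D.spinGamma 1 C 0 0) x = 2 * D.curvX 0 1 0 0 x := by
  have h := fun A A' ↦ D.spinGamma_swap A A' 0 1 x
  simp only [curvX_eq, spinCurv_eq, connSpinor_eq, Fin.sum_univ_two, D.partialD_shear hκ, rayCurl]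
  simp [spinEps, hκ, rayBracket, h]
  ring

/-- The curl of `(ε, β)`. -/
theorem rayCurl_eps_beta (hκ : ∀ A' x, D.spinGamma 0 A' 0 0 x = 0) (x : M) :
    D.rayCurl (fun C ↦ D.spinGamma 0 C 0 1) x = D.curvX 0 1 0 0 x := by
  have h := fun A A' ↦ D.spinGamma_swap A A' 0 1 x
  rw [curvX_pair_symm]
  simp only [curvX_eq, spinCurv_eq, connSpinor_eq, Fin.sum_univ_two, rayCurl]
  simp [spinEps, hκ, rayBracket, h]
  ring

/-- The connection on upper primed indices along the ray. -/
def rayPrimed (A B Q : Fin 2) (x : M) : ℂ :=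
  ∑ E, spinEps B E * conj (D.spinGamma A 0 Q E x) + spinDelta A B * D.spinGamma 1 Q 0 0 x

theorem partialD_conj_spinGamma (A A' B B' C E : Fin 2) (x : M) :
    D.partialD A A' (fun y ↦ conj (D.spinGamma B B' C E y)) x
      = conj (D.partialD A' A (D.spinGamma B B' C E) x) :=
  D.partialD_conj A A' (D.contMDiff_spinGamma B B' C E) x

theorem partialD_rayPrimed (A A' C B Q : Fin 2) (x : M) :
    D.partialD A A' (D.rayPrimed C B Q) x
      = ∑ E, spinEps B E * conj (D.partialD A' A (D.spinGamma C 0 Q E) x)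
        + spinDelta C B * D.partialD A A' (D.spinGamma 1 Q 0 0) x := by
  have h : ∀ E, ContMDiff (𝓡 4) 𝓘(ℝ, ℂ) ∞ (fun y ↦ conj (D.spinGamma C 0 Q E y)) := fun E ↦
    contMDiff_conj (D.contMDiff_spinGamma C 0 Q E)
  unfold rayPrimed
  rw [D.partialD_add A A' (contMDiff_sum fun E ↦ contMDiff_const_mul _ (h E))
    (contMDiff_const_mul _ (D.contMDiff_spinGamma 1 Q 0 0)),
    D.partialD_const_mul A A' _ (D.contMDiff_spinGamma 1 Q 0 0),
    D.partialD_sum A A' fun E ↦ contMDiff_const_mul _ (h E)]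
  simp only [D.partialD_const_mul A A' _ (h _), partialD_conj_spinGamma]

/-- The curvature of the connection on primed indices along the ray. -/
theorem rayPrimed_curvature (hκ : ∀ A' x, D.spinGamma 0 A' 0 0 x = 0) (B Q : Fin 2) (x : M) :
    D.rayCurl (fun C ↦ D.rayPrimed C B Q) x
      + ∑ R, (D.rayPrimed 0 B R x * D.rayPrimed 1 R Q x
        - D.rayPrimed 1 B R x * D.rayPrimed 0 R Q x)
      = spinDelta B Q * D.curvX 0 1 0 0 x := by
  have h := fun A A' ↦ D.spinGamma_swap A A' 0 1 x
  have h' : ∀ A A', D.spinGamma A A' 1 0 = D.spinGamma A A' 0 1 := fun A A' ↦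
    funext fun y ↦ D.spinGamma_swap A A' 0 1 y
  have e1 := D.sum_spinEps_spinCurv 0 0 0 0 x
  have e2 := D.sum_spinEps_spinCurv 0 1 0 0 x
  have e3 := D.sum_spinEps_spinCurv 1 1 0 0 x
  have e4 := D.curvX_eq 0 1 0 0 x
  simp only [spinCurv_eq, connSpinor_eq, Fin.sum_univ_two, D.partialD_shear hκ] at e1 e2 e3 e4
  simp [spinEps, hκ, h] at e1 e2 e3 e4
  simp only [rayCurl, partialD_rayPrimed, Fin.sum_univ_two]
  fin_cases B <;> fin_cases Q
  · simp [spinEps, hκ, rayBracket, h, rayPrimed, spinDelta, D.partialD_shear hκ]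
    linear_combination -(1 / 2) * e2 - e4
  · simp [spinEps, hκ, rayBracket, h, h', rayPrimed, spinDelta]
    linear_combination -(1 / 2) * e3
  · simp [spinEps, hκ, rayBracket, h, rayPrimed, spinDelta, D.partialD_shear hκ]
    linear_combination (1 / 2) * e1
  · simp [spinEps, hκ, rayBracket, h, h', rayPrimed, spinDelta]
    linear_combination (1 / 2) * e2 - e4

/-! ### The operators `C̃_{A'}` along a shear-free ray -/

/-- The one-form `w f_a + p (ω_a + B_a)` along the ray. -/
def rayWeight (p : ℤ) (w : ℝ) (C : Fin 2) (x : M) : ℂ :=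
  (w : ℂ) * D.formF 0 C x + (p : ℂ) * (D.formOmega 0 C x + D.formB 0 C x)

/-- The matrix of `C̃_{A'}` on an index of the given kind. -/
def rayConn (C : Fin 2) (s : SpinorIndex) (B Q : Fin 2) (x : M) : ℂ :=
  D.indexConn 0 C s B Q x + D.indexCorr 0 C s B Q x

theorem cTilde_cons {k : ℕ} (τ : Fin k → SpinorIndex) (p : ℤ) (w : ℝ) (φ : SpinorField M k)
    (C : Fin 2) (I : Fin k → Fin 2) (x : M) :
    D.cTilde τ p w φ (Fin.cons (α := fun _ ↦ Fin 2) C I) x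
      = D.partialD 0 C (φ I) x + D.rayWeight p w C x * φ I x
        + ∑ i, ∑ Q, D.rayConn C (τ i) (I i) Q x * φ (Function.update I i Q) x := by
  simp only [cTilde, conformalGHP, nabla, rayWeight, rayConn, Fin.sum_univ_two (f := fun A ↦
    spinO A * _), Fin.cons_zero, Fin.tail_cons, add_mul, Finset.sum_add_distrib]
  simp only [spinO, Matrix.cons_val_zero, Matrix.cons_val_one, one_mul, zero_mul]
  ring

theorem formF_ray (C : Fin 2) (x : M) : D.formF 0 C x = D.spinGamma 1 C 0 0 x := by
  fin_cases C <;>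
  simp [formF, rho, rhoP, tau, tauP, spinCoeff, nablaLower, nabla, Fin.sum_univ_two, spinO,
    spinIota, indexConn, spinConn_eq, spinEps, spinLower, partialD_const, spinCovector]

theorem formF_transverse (C : Fin 2) (x : M) : D.formF 1 C x = -D.spinGamma 0 C 1 1 x := by
  fin_cases C <;>
  simp [formF, rho, rhoP, tau, tauP, spinCoeff, nablaLower, nabla, Fin.sum_univ_two, spinO,
    spinIota, indexConn, spinConn_eq, spinEps, spinLower, partialD_const, spinCovector]

theorem formOmega_ray (C : Fin 2) (x : M) : D.formOmega 0 C x = -D.spinGamma 0 C 0 1 x := by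
  have h := fun A A' ↦ D.spinGamma_swap A A' 0 1 x
  fin_cases C <;>
  simp [formOmega, eps, epsP, beta, betaP, spinCoeff, nablaLower, nabla, Fin.sum_univ_two, spinO,
    spinIota, indexConn, spinConn_eq, spinEps, spinLower, partialD_const, spinCovector, h]

theorem formB_ray (C : Fin 2) (x : M) : D.formB 0 C x = -D.spinGamma 1 C 0 0 x := by
  fin_cases C <;>
  simp [formB, rho, tau, spinCoeff, nablaLower, nabla, Fin.sum_univ_two, spinO,
    spinIota, indexConn, spinConn_eq, spinEps, spinLower, partialD_const, spinCovector]

theorem rayWeight_eq (p : ℤ) (w : ℝ) (C : Fin 2) (x : M) :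
    D.rayWeight p w C x
      = ((w : ℂ) - p) * D.spinGamma 1 C 0 0 x + (-p) * D.spinGamma 0 C 0 1 x := by
  rw [rayWeight, formF_ray, formOmega_ray, formB_ray]
  ring

theorem rayConn_up (hκ : ∀ A' x, D.spinGamma 0 A' 0 0 x = 0) (C B Q : Fin 2) (x : M) :
    D.rayConn C .up B Q x
      = !![1, 0; 0, 0] B Q * D.spinGamma 1 C 0 0 x
        + !![1, 0; 0, -1] B Q * D.spinGamma 0 C 0 1 x := by
  have h := D.spinGamma_swap 0 C 0 1 x
  fin_cases B <;> fin_cases Q <;>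
    simp [rayConn, indexConn, indexCorr, spinConn_eq, Fin.sum_univ_two, spinEps, spinDelta,
      formF_ray, formF_transverse, hκ, h, add_comm]

theorem rayConn_upPrime (C B Q : Fin 2) (x : M) :
    D.rayConn C .upPrime B Q x = D.rayPrimed C B Q x := by
  simp [rayConn, indexConn, indexCorr, rayPrimed, spinConn_eq, formF_ray, conj_spinEps]

theorem rayConn_down (C B Q : Fin 2) (x : M) :
    D.rayConn C .down B Q x = -D.rayConn C .up Q B x := by
  simp only [rayConn, indexConn, indexCorr]
  ring

theorem rayConn_downPrime (C B Q : Fin 2) (x : M) :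
    D.rayConn C .downPrime B Q x = -D.rayConn C .upPrime Q B x := by
  simp only [rayConn, indexConn, indexCorr]
  ring

theorem contMDiff_rayWeight (p : ℤ) (w : ℝ) (C : Fin 2) :
    ContMDiff (𝓡 4) 𝓘(ℝ, ℂ) ∞ (D.rayWeight p w C) := by
  rw [funext (D.rayWeight_eq p w C)]
  exact (contMDiff_const_mul _ (D.contMDiff_spinGamma 1 C 0 0)).add
    (contMDiff_const_mul _ (D.contMDiff_spinGamma 0 C 0 1))

theorem contMDiff_rayPrimed (C B Q : Fin 2) :
    ContMDiff (𝓡 4) 𝓘(ℝ, ℂ) ∞ (D.rayPrimed C B Q) :=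
  (contMDiff_sum fun E ↦ contMDiff_const_mul _ (contMDiff_conj (D.contMDiff_spinGamma C 0 Q E))).add
    (contMDiff_const_mul _ (D.contMDiff_spinGamma 1 Q 0 0))

theorem contMDiff_neg {f : M → ℂ} (hf : ContMDiff (𝓡 4) 𝓘(ℝ, ℂ) ∞ f) :
    ContMDiff (𝓡 4) 𝓘(ℝ, ℂ) ∞ (fun x ↦ -f x) := by
  simpa using contMDiff_const_mul (-1) hf

theorem contMDiff_rayConn (hκ : ∀ A' x, D.spinGamma 0 A' 0 0 x = 0) (C : Fin 2) (s : SpinorIndex)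
    (B Q : Fin 2) : ContMDiff (𝓡 4) 𝓘(ℝ, ℂ) ∞ (D.rayConn C s B Q) := by
  have up : ∀ B Q, ContMDiff (𝓡 4) 𝓘(ℝ, ℂ) ∞ (D.rayConn C .up B Q) := fun B Q ↦ by
    rw [funext (D.rayConn_up hκ C B Q)]
    exact (contMDiff_const_mul _ (D.contMDiff_spinGamma 1 C 0 0)).add
      (contMDiff_const_mul _ (D.contMDiff_spinGamma 0 C 0 1))
  have upPrime : ∀ B Q, ContMDiff (𝓡 4) 𝓘(ℝ, ℂ) ∞ (D.rayConn C .upPrime B Q) := fun B Q ↦ by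
    rw [funext (D.rayConn_upPrime C B Q)]
    exact D.contMDiff_rayPrimed C B Q
  cases s with
  | up => exact up B Q
  | down =>
    rw [funext (D.rayConn_down C B Q)]
    exact contMDiff_neg (up Q B)
  | upPrime => exact upPrime B Q
  | downPrime =>
    rw [funext (D.rayConn_downPrime C B Q)]
    exact contMDiff_neg (upPrime Q B)

/-! ### Curvature along the ray -/

theorem rayCurl_linear (a b : ℂ) {f h : Fin 2 → M → ℂ}
    (hf : ∀ C, ContMDiff (𝓡 4) 𝓘(ℝ, ℂ) ∞ (f C)) (hh : ∀ C, ContMDiff (𝓡 4) 𝓘(ℝ, ℂ) ∞ (h C))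
    (x : M) :
    D.rayCurl (fun C y ↦ a * f C y + b * h C y) x = a * D.rayCurl f x + b * D.rayCurl h x := by
  simp only [rayCurl, D.partialD_add 0 _ (contMDiff_const_mul _ (hf _))
    (contMDiff_const_mul _ (hh _)), D.partialD_const_mul 0 _ _ (hf _),
    D.partialD_const_mul 0 _ _ (hh _), Fin.sum_univ_two]
  ring

theorem rayCurl_neg {f : Fin 2 → M → ℂ} (hf : ∀ C, ContMDiff (𝓡 4) 𝓘(ℝ, ℂ) ∞ (f C)) (x : M) :
    D.rayCurl (fun C y ↦ -f C y) x = -D.rayCurl f x := by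
  simp only [rayCurl, D.partialD_neg 0 _ (hf _), Fin.sum_univ_two]
  ring

theorem rayCurl_rayWeight (hκ : ∀ A' x, D.spinGamma 0 A' 0 0 x = 0) (p : ℤ) (w : ℝ) (x : M) :
    D.rayCurl (D.rayWeight p w) x = (2 * w - 3 * p) * D.curvX 0 1 0 0 x := by
  have h : D.rayWeight p w = fun C y ↦
      ((w : ℂ) - p) * D.spinGamma 1 C 0 0 y + (-p) * D.spinGamma 0 C 0 1 y :=
    funext fun C ↦ funext (D.rayWeight_eq p w C)
  rw [h, D.rayCurl_linear _ _ (fun C ↦ D.contMDiff_spinGamma 1 C 0 0)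
    (fun C ↦ D.contMDiff_spinGamma 0 C 0 1), D.rayCurl_rho_tau hκ, D.rayCurl_eps_beta hκ]
  ring

/-- The curvature of `C̃` on an index of the given kind. -/
def rayCurv (s : SpinorIndex) (B Q : Fin 2) (x : M) : ℂ :=
  D.rayCurl (fun C ↦ D.rayConn C s B Q) x
    + ∑ R, (D.rayConn 0 s B R x * D.rayConn 1 s R Q x - D.rayConn 1 s B R x * D.rayConn 0 s R Q x)

theorem rayCurv_eq_zero (hκ : ∀ A' x, D.spinGamma 0 A' 0 0 x = 0) {x : M}
    (hΨ : D.curvX 0 1 0 0 x = 0) (s : SpinorIndex) (B Q : Fin 2) : D.rayCurv s B Q x = 0 := by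
  have up : ∀ B Q, D.rayCurv .up B Q x = 0 := fun B Q ↦ by
    have h : (fun C ↦ D.rayConn C .up B Q) = fun C y ↦
        !![1, 0; 0, 0] B Q * D.spinGamma 1 C 0 0 y
          + !![1, 0; 0, -1] B Q * D.spinGamma 0 C 0 1 y :=
      funext fun C ↦ funext (D.rayConn_up hκ C B Q)
    rw [rayCurv, h, D.rayCurl_linear _ _ (fun C ↦ D.contMDiff_spinGamma 1 C 0 0)
      (fun C ↦ D.contMDiff_spinGamma 0 C 0 1), D.rayCurl_rho_tau hκ, D.rayCurl_eps_beta hκ, hΨ]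
    simp only [D.rayConn_up hκ, Fin.sum_univ_two]
    fin_cases B <;> fin_cases Q <;> simp <;> ring
  have upPrime : ∀ B Q, D.rayCurv .upPrime B Q x = 0 := fun B Q ↦ by
    have h : (fun C ↦ D.rayConn C .upPrime B Q) = fun C ↦ D.rayPrimed C B Q :=
      funext fun C ↦ funext (D.rayConn_upPrime C B Q)
    rw [rayCurv, h]
    simp only [rayConn_upPrime]
    rw [D.rayPrimed_curvature hκ, hΨ, mul_zero]
  cases s with
  | up => exact up B Q
  | upPrime => exact upPrime B Q
  | down =>
    have h : (fun C ↦ D.rayConn C .down B Q) = fun C y ↦ -D.rayConn C .up Q B y :=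
      funext fun C ↦ funext (D.rayConn_down C B Q)
    have := up Q B
    rw [rayCurv, Fin.sum_univ_two] at this
    rw [rayCurv, h, D.rayCurl_neg fun C ↦ D.contMDiff_rayConn hκ C .up Q B, Fin.sum_univ_two]
    simp only [rayConn_down]
    linear_combination -this
  | downPrime =>
    have h : (fun C ↦ D.rayConn C .downPrime B Q) = fun C y ↦ -D.rayConn C .upPrime Q B y :=
      funext fun C ↦ funext (D.rayConn_downPrime C B Q)
    have := upPrime Q B
    rw [rayCurv, Fin.sum_univ_two] at this
    rw [rayCurv, h, D.rayCurl_neg fun C ↦ D.contMDiff_rayConn hκ C .upPrime Q B, Fin.sum_univ_two]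
    simp only [rayConn_downPrime]
    linear_combination -this

/-! ### The commutator of `C̃_{A'}` and `C̃_{B'}` -/

/-- Matrices acting on different indices commute, so the commutator of two sums of matrices acting
on the single indices is the sum of the commutators. -/
theorem sum_update_commutator {k : ℕ} (a b : Fin k → Fin 2 → Fin 2 → ℂ)
    (v : (Fin k → Fin 2) → ℂ) (I : Fin k → Fin 2) :
    (∑ i, ∑ Q, a i (I i) Q * ∑ j, ∑ R, b j (Function.update I i Q j) R
          * v (Function.update (Function.update I i Q) j R))
        - ∑ i, ∑ Q, b i (I i) Q * ∑ j, ∑ R, a j (Function.update I i Q j) R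
          * v (Function.update (Function.update I i Q) j R)
      = ∑ i, ∑ Q, (∑ R, (a i (I i) R * b i R Q - b i (I i) R * a i R Q))
          * v (Function.update I i Q) := by
  let S : (Fin k → Fin 2 → Fin 2 → ℂ) → (Fin k → Fin 2 → Fin 2 → ℂ) → Fin k → Fin k → ℂ :=
    fun c d i j ↦ ∑ Q, ∑ R, c i (I i) Q * (d j (Function.update I i Q j) R
      * v (Function.update (Function.update I i Q) j R))
  have hS : ∀ c d : Fin k → Fin 2 → Fin 2 → ℂ,
      ∑ i, ∑ Q, c i (I i) Q * ∑ j, ∑ R, d j (Function.update I i Q j) R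
        * v (Function.update (Function.update I i Q) j R) = ∑ i, ∑ j, S c d i j := by
    intro c d
    refine Finset.sum_congr rfl fun i _ ↦ ?_
    simp only [Finset.mul_sum, S]
    rw [Finset.sum_comm]
  have hne : ∀ i j, i ≠ j → S a b i j = S b a j i := by
    intro i j hij
    simp only [S]
    rw [Finset.sum_comm]
    refine Finset.sum_congr rfl fun R _ ↦ Finset.sum_congr rfl fun Q _ ↦ ?_
    rw [Function.update_of_ne hij.symm, Function.update_of_ne hij, Function.update_comm hij]
    ring
  rw [hS, hS, Finset.sum_comm (f := S b a), ← Finset.sum_sub_distrib]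
  refine Finset.sum_congr rfl fun i _ ↦ ?_
  rw [← Finset.sum_sub_distrib, Finset.sum_eq_single i
    (fun j _ hj ↦ sub_eq_zero.2 (hne i j hj.symm)) (by simp)]
  simp only [S, Function.update_self, Function.update_idem, Fin.sum_univ_two]
  ring

theorem partialD_cTilde_cons (hκ : ∀ A' x, D.spinGamma 0 A' 0 0 x = 0) {k : ℕ}
    (τ : Fin k → SpinorIndex) (p : ℤ) (w : ℝ) {φ : SpinorField M k}
    (hφ : ∀ I, ContMDiff (𝓡 4) 𝓘(ℝ, ℂ) ∞ (φ I)) (A C : Fin 2) (I : Fin k → Fin 2) (x : M) :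
    D.partialD 0 A (D.cTilde τ p w φ (Fin.cons (α := fun _ ↦ Fin 2) C I)) x
      = D.partialD 0 A (D.partialD 0 C (φ I)) x
        + (D.partialD 0 A (D.rayWeight p w C) x * φ I x
          + D.rayWeight p w C x * D.partialD 0 A (φ I) x)
        + ∑ i, ∑ Q, (D.partialD 0 A (D.rayConn C (τ i) (I i) Q) x * φ (Function.update I i Q) x
          + D.rayConn C (τ i) (I i) Q x * D.partialD 0 A (φ (Function.update I i Q)) x) := by
  have h1 : ∀ i Q, ContMDiff (𝓡 4) 𝓘(ℝ, ℂ) ∞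
      (fun y ↦ D.rayConn C (τ i) (I i) Q y * φ (Function.update I i Q) y) := fun i Q ↦
    contMDiff_mul (D.contMDiff_rayConn hκ C (τ i) (I i) Q) (hφ _)
  have h2 := D.contMDiff_partialD 0 C (hφ I)
  have h3 := contMDiff_mul (D.contMDiff_rayWeight p w C) (hφ I)
  have h4 : ContMDiff (𝓡 4) 𝓘(ℝ, ℂ) ∞
      (fun y ↦ D.partialD 0 C (φ I) y + D.rayWeight p w C y * φ I y) := h2.add h3
  rw [funext (D.cTilde_cons τ p w φ C I), D.partialD_add 0 A h4
    (contMDiff_sum fun i ↦ contMDiff_sum fun Q ↦ h1 i Q), D.partialD_add 0 A h2 h3,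
    D.partialD_mul 0 A (D.contMDiff_rayWeight p w C) (hφ I),
    D.partialD_sum 0 A (fun i ↦ contMDiff_sum fun Q ↦ h1 i Q)]
  simp only [D.partialD_sum 0 A (h1 _),
    D.partialD_mul 0 A (D.contMDiff_rayConn hκ C _ _ _) (hφ _)]

theorem cTildeSq_cons {k : ℕ} (τ : Fin k → SpinorIndex) (p : ℤ) (w : ℝ) (φ : SpinorField M k)
    (A C : Fin 2) (I : Fin k → Fin 2) (x : M) :
    D.cTildeSq τ p w φ
        (Fin.cons (α := fun _ ↦ Fin 2) A (Fin.cons (α := fun _ ↦ Fin 2) C I)) x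
      = D.partialD 0 A (D.cTilde τ p w φ (Fin.cons (α := fun _ ↦ Fin 2) C I)) x
        + D.rayWeight (p + 1) w A x * D.cTilde τ p w φ (Fin.cons (α := fun _ ↦ Fin 2) C I) x
        + (∑ Q, D.rayConn A .downPrime C Q x
            * D.cTilde τ p w φ (Fin.cons (α := fun _ ↦ Fin 2) Q I) x
          + ∑ i, ∑ Q, D.rayConn A (τ i) (I i) Q x * D.cTilde τ p w φ
              (Fin.cons (α := fun _ ↦ Fin 2) C (Function.update I i Q)) x) := by
  rw [cTildeSq, cTilde_cons, Fin.sum_univ_succ]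
  simp only [Fin.cons_zero, Fin.cons_succ, Fin.update_cons_zero, Fin.cons_update]

/-- The torsion of `C̃` vanishes. -/
theorem rayTorsion (p : ℤ) (w : ℝ) (E : Fin 2 → ℂ) (x : M) :
    D.rayWeight (p + 1) w 0 x * E 1 - D.rayWeight (p + 1) w 1 x * E 0
        + (∑ Q, D.rayConn 0 .downPrime 1 Q x * E Q - ∑ Q, D.rayConn 1 .downPrime 0 Q x * E Q)
      = D.rayWeight p w 0 x * E 1 - D.rayWeight p w 1 x * E 0 - ∑ C, D.rayBracket C x * E C := by
  have h := fun A A' ↦ D.spinGamma_swap A A' 0 1 x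
  simp only [rayConn_downPrime, rayConn_upPrime, rayWeight_eq, Fin.sum_univ_two]
  simp [rayPrimed, rayBracket, spinEps, spinDelta, Fin.sum_univ_two, h]
  ring

theorem cTildeComm_zero_one (hκ : ∀ A' x, D.spinGamma 0 A' 0 0 x = 0) {k : ℕ}
    (τ : Fin k → SpinorIndex) (p : ℤ) (w : ℝ) {φ : SpinorField M k}
    (hφ : ∀ I, ContMDiff (𝓡 4) 𝓘(ℝ, ℂ) ∞ (φ I)) (I : Fin k → Fin 2) (x : M) :
    D.cTildeComm τ p w φ 0 1 I x
      = D.rayCurl (D.rayWeight p w) x * φ I x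
        + ∑ i, ∑ Q, D.rayCurv (τ i) (I i) Q x * φ (Function.update I i Q) x := by
  have hT := D.rayTorsion p w
    (fun C ↦ D.cTilde τ p w φ (Fin.cons (α := fun _ ↦ Fin 2) C I) x) x
  have hX := D.partialD_comm_ray hκ (hφ I) x
  have hK := sum_update_commutator (fun i B Q ↦ D.rayConn 0 (τ i) B Q x)
    (fun i B Q ↦ D.rayConn 1 (τ i) B Q x) (fun J ↦ φ J x) I
  have hE : ∀ A C, ∑ i, ∑ Q, D.rayConn A (τ i) (I i) Q x * D.cTilde τ p w φ
        (Fin.cons (α := fun _ ↦ Fin 2) C (Function.update I i Q)) x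
      = ∑ i, ∑ Q, D.rayConn A (τ i) (I i) Q x * D.partialD 0 C (φ (Function.update I i Q)) x
        + D.rayWeight p w C x
          * ∑ i, ∑ Q, D.rayConn A (τ i) (I i) Q x * φ (Function.update I i Q) x
        + ∑ i, ∑ Q, D.rayConn A (τ i) (I i) Q x * ∑ j, ∑ R,
          D.rayConn C (τ j) (Function.update I i Q j) R x
            * φ (Function.update (Function.update I i Q) j R) x := fun A C ↦ by
    simp only [cTilde_cons, mul_add, Finset.sum_add_distrib]
    congr 2
    simp only [Finset.mul_sum]
    exact Finset.sum_congr rfl fun i _ ↦ Finset.sum_congr rfl fun Q _ ↦ by ring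
  have hR : ∑ i, ∑ Q, D.rayCurv (τ i) (I i) Q x * φ (Function.update I i Q) x
      = ∑ i, ∑ Q, D.partialD 0 0 (D.rayConn 1 (τ i) (I i) Q) x * φ (Function.update I i Q) x
        - ∑ i, ∑ Q, D.partialD 0 1 (D.rayConn 0 (τ i) (I i) Q) x * φ (Function.update I i Q) x
        - (D.rayBracket 0 x
            * ∑ i, ∑ Q, D.rayConn 0 (τ i) (I i) Q x * φ (Function.update I i Q) x
          + D.rayBracket 1 x
            * ∑ i, ∑ Q, D.rayConn 1 (τ i) (I i) Q x * φ (Function.update I i Q) x)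
        + ∑ i, ∑ Q, (∑ R, (D.rayConn 0 (τ i) (I i) R x * D.rayConn 1 (τ i) R Q x
          - D.rayConn 1 (τ i) (I i) R x * D.rayConn 0 (τ i) R Q x))
            * φ (Function.update I i Q) x := by
    simp only [rayCurv, rayCurl, Fin.sum_univ_two (f := fun C ↦ D.rayBracket C x * _), add_mul,
      sub_mul, Finset.sum_add_distrib, Finset.sum_sub_distrib, Finset.mul_sum, mul_assoc]
  rw [cTildeComm, cTildeSq_cons, cTildeSq_cons, D.partialD_cTilde_cons hκ τ p w hφ,
    D.partialD_cTilde_cons hκ τ p w hφ, hE, hE, hR, rayCurl]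
  simp only [Finset.sum_add_distrib]
  simp only [Fin.sum_univ_two (f := fun C ↦ D.rayBracket C x * _)] at hT hX ⊢
  have hE0 := D.cTilde_cons τ p w φ 0 I x
  have hE1 := D.cTilde_cons τ p w φ 1 I x
  linear_combination hT + hX + hK + (D.rayWeight p w 0 x - D.rayBracket 1 x) * hE1
    - (D.rayWeight p w 1 x + D.rayBracket 0 x) * hE0

theorem cTildeComm_swap {k : ℕ} (τ : Fin k → SpinorIndex) (p : ℤ) (w : ℝ) (φ : SpinorField M k)
    (A' B' : Fin 2) (I : Fin k → Fin 2) (x : M) :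
    D.cTildeComm τ p w φ B' A' I x = -D.cTildeComm τ p w φ A' B' I x := by
  simp only [cTildeComm, neg_sub]

end SpinDyad

end

theorem ctilde_flat_iff_repeated_principal
    {M : Type*} [TopologicalSpace M] [ChartedSpace (EuclideanSpace ℝ (Fin 4)) M]
    [IsManifold (𝓡 4) ∞ M]
    (g : LorentzianMetric M) (D : SpinDyad g) (hSFR : D.IsShearFreeRay) :
    (∀ (k : ℕ) (τ : Fin k → SpinorIndex) (p : ℤ) (w : ℝ) (φ : SpinorField M k),
      (∀ I, ContMDiff (𝓡 4) 𝓘(ℝ, ℂ) ∞ (φ I)) →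
        ∀ (A' B' : Fin 2) (I : Fin k → Fin 2) (x : M), D.cTildeComm τ p w φ A' B' I x = 0)
      ↔ D.IsRepeatedPrincipal := by
  have hκ := D.isShearFreeRay_iff.1 hSFR
  rw [D.isRepeatedPrincipal_iff]
  constructor
  · intro h x
    refine ⟨D.curvX_zero hκ x, ?_⟩
    have h1 := h 0 Fin.elim0 0 1 (fun _ _ ↦ 1) (fun _ ↦ contMDiff_const) 0 1 Fin.elim0 x
    rw [D.cTildeComm_zero_one hκ _ _ _ (fun _ ↦ contMDiff_const), D.rayCurl_rayWeight hκ] at h1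
    simpa using h1
  · intro h k τ p w φ hφ A' B' I x
    have h01 : D.cTildeComm τ p w φ 0 1 I x = 0 := by
      rw [D.cTildeComm_zero_one hκ τ p w hφ, D.rayCurl_rayWeight hκ, (h x).2]
      simp [D.rayCurv_eq_zero hκ (h x).2]
    fin_cases A' <;> fin_cases B'
    · exact sub_self _
    · exact h01
    · exact (D.cTildeComm_swap τ p w φ 0 1 I x).trans (by rw [h01, neg_zero])
    · exact sub_self _
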